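/- arXiv:math/0606689 — 5 statements merged into one kernel-verified Lean document; each statement's English description precedes it below -/
import Mathlib

section
/- Let A be a one-dimensional commutative ring. Then A is a stably strong S-ring if and only if A is a strong S-ring, and this holds if and only if every height-one prime P of A satisfies ht(P[X]) = 1 in A[X]. -/
open Polynomial TensorProduct

/-- A ring satisfies MPC if its minimal primes are pairwise comaximal. -/
def MPC (A : Type*) [CommRing A] : Prop :=
  ∀ p ∈ minimalPrimes A, ∀ q ∈ minimalPrimes A, p ≠ q → p ⊔ q = ⊤

/-- A domain is an S-domain if every height-one prime `p` satisfies `ht (p[X]) = 1`. -/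
def IsSDomain (D : Type*) [CommRing D] [IsDomain D] : Prop :=
  ∀ p : PrimeSpectrum D, Order.height p = 1 →
    ∀ P : PrimeSpectrum D[X], P.asIdeal = p.asIdeal.map (C : D →+* D[X]) →
      Order.height P = 1

/-- A ring is a strong S-ring if the quotient by every prime is an S-domain. -/
def StrongSRing (A : Type*) [CommRing A] : Prop :=
  ∀ p : PrimeSpectrum A, IsSDomain (A ⧸ p.asIdeal)

/-- A ring is a stably strong S-ring if all polynomial rings over it in `n ≥ 1`
variables are strong S-rings. -/
def StablyStrongSRing (A : Type*) [CommRing A] : Prop :=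
  ∀ n : ℕ, 0 < n → StrongSRing (MvPolynomial (Fin n) A)

/-- A ring is locally finite dimensional (LFD) if every prime has finite height. -/
def LFD (A : Type*) [CommRing A] : Prop :=
  ∀ p : PrimeSpectrum A, Order.height p ≠ ⊤

/-- A ring is catenarian if it satisfies MPC, is LFD, and adjacent primes `P ⋖ Q`
satisfy `ht Q = ht P + 1`. -/
def Catenarian (A : Type*) [CommRing A] : Prop :=
  MPC A ∧ LFD A ∧
    ∀ P Q : PrimeSpectrum A, P ⋖ Q → Order.height Q = Order.height P + 1

/-- A ring is universally catenarian if all polynomial rings over it in `n ≥ 1`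
variables are catenarian. -/
def UniversallyCatenarian (A : Type*) [CommRing A] : Prop :=
  ∀ n : ℕ, 0 < n → Catenarian (MvPolynomial (Fin n) A)

/-- An S-ring: MPC together with the quotient by each minimal prime being an S-domain. -/
def SRing (A : Type*) [CommRing A] : Prop :=
  MPC A ∧ ∀ p : PrimeSpectrum A, p.asIdeal ∈ minimalPrimes A → IsSDomain (A ⧸ p.asIdeal)

/-- The transcendence degree of a `k`-algebra `A`: the supremum of the cardinalities
of algebraically independent subsets of `A` over `k`. -/
noncomputable def trdeg (k A : Type*) [CommRing k] [CommRing A] [Algebra k A] : Cardinal :=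
  ⨆ s : {s : Set A // AlgebraicIndependent k ((↑) : s → A)}, Cardinal.mk s.1


theorem Order.height_eq_one_iff_isMin {α : Type*} [PartialOrder α] (x : α) :
    Order.height x = 1 ↔ ¬ IsMin x ∧ ∀ y < x, IsMin y := by
  have h : Order.height x ≤ 1 ↔ ∀ y < x, IsMin y := by
    simpa using Order.height_le_coe_iff (x := x) (n := 1)
  rw [← h, ← Order.height_pos, ← Order.one_le_iff_pos, and_comm, le_antisymm_iff]

theorem Ideal.IsPrime.map_C {R : Type*} [CommRing R] {p : Ideal R} (hp : p.IsPrime) :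
    (p.map (C : R →+* R[X])).IsPrime :=
  haveI := hp
  Ideal.isPrime_map_C_of_isPrime

theorem Ideal.map_C_le_map_C_iff {R : Type*} [CommRing R] {p q : Ideal R} :
    p.map (C : R →+* R[X]) ≤ q.map C ↔ p ≤ q := by
  refine ⟨fun h x hx ↦ ?_, fun h ↦ Ideal.map_mono h⟩
  simpa using Ideal.mem_map_C_iff.mp (h (Ideal.mem_map_of_mem C hx)) 0

theorem Ideal.comap_C_map_C {R : Type*} [CommRing R] (p : Ideal R) :
    (p.map (C : R →+* R[X])).comap C = p := by
  refine le_antisymm (fun x hx ↦ ?_) Ideal.le_comap_map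
  simpa using Ideal.mem_map_C_iff.mp hx 0

/-- In a domain, a prime has height one iff it is a minimal nonzero prime. -/
theorem PrimeSpectrum.height_eq_one_iff_of_isDomain {D : Type*} [CommRing D] [IsDomain D]
    (P : PrimeSpectrum D) :
    Order.height P = 1 ↔ P.asIdeal ≠ ⊥ ∧
      ∀ q : Ideal D, q.IsPrime → q ≤ P.asIdeal → q = ⊥ ∨ q = P.asIdeal := by
  rw [Order.height_eq_one_iff_isMin]
  have hmin (Q : PrimeSpectrum D) : IsMin Q ↔ Q.asIdeal = ⊥ := by
    rw [isMin_iff_eq_bot, PrimeSpectrum.ext_iff]; rfl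
  simp only [hmin]
  refine and_congr Iff.rfl ⟨fun h q hq hle ↦ ?_, fun h Q hQ ↦ ?_⟩
  · rcases hle.lt_or_eq with h' | h'
    · exact .inl (h ⟨q, hq⟩ h')
    · exact .inr h'
  · exact (h _ Q.2 hQ.le).resolve_right (hQ.ne ∘ PrimeSpectrum.ext)

theorem isSDomain_iff {D : Type*} [CommRing D] [IsDomain D] :
    IsSDomain D ↔ ∀ m : Ideal D, m.IsPrime → m ≠ ⊥ →
      (∀ q : Ideal D, q.IsPrime → q ≤ m → q = ⊥ ∨ q = m) →
      ∀ I : Ideal D[X], I.IsPrime → I ≤ m.map C → I = ⊥ ∨ I = m.map C := by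
  constructor
  · intro h m hm hm0 hmin
    have := h ⟨m, hm⟩ ((PrimeSpectrum.height_eq_one_iff_of_isDomain _).mpr ⟨hm0, hmin⟩)
      ⟨m.map C, hm.map_C⟩ rfl
    exact ((PrimeSpectrum.height_eq_one_iff_of_isDomain _).mp this).2
  · intro h p hp P hP
    obtain ⟨h0, hmin⟩ := (PrimeSpectrum.height_eq_one_iff_of_isDomain _).mp hp
    refine (PrimeSpectrum.height_eq_one_iff_of_isDomain _).mpr ⟨?_, ?_⟩
    · rw [hP]
      exact fun h ↦ h0 ((Ideal.map_eq_bot_iff_of_injective C_injective).mp h)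
    · rw [hP]
      exact h _ p.2 h0 hmin

/-- If every prime between `m` and the kernel of a surjection `f` onto a domain is trivial,
then so is every prime between the corresponding extended primes. -/
theorem isSDomain_iff_of_surjective {A D : Type*} [CommRing A] [CommRing D] [IsDomain D]
    {f : A →+* D} (hf : Function.Surjective f) :
    IsSDomain D ↔ ∀ m : Ideal A, m.IsPrime → RingHom.ker f < m →
      (∀ q : Ideal A, q.IsPrime → RingHom.ker f ≤ q → q ≤ m → q = RingHom.ker f ∨ q = m) →
      ∀ I : Ideal A[X], I.IsPrime → (RingHom.ker f).map C ≤ I → I ≤ m.map C →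
        I = (RingHom.ker f).map C ∨ I = m.map C := by
  have hF : Function.Surjective (mapRingHom f) := map_surjective f hf
  have hker : RingHom.ker (mapRingHom f) = (RingHom.ker f).map C := ker_mapRingHom f
  have hcomap (p : Ideal D) : (p.map C).comap (mapRingHom f) = (p.comap f).map C := by
    ext g
    simp [Ideal.mem_map_C_iff]
  rw [isSDomain_iff]
  constructor
  · intro h m hm hlt hmin I hI hle hIm
    have hm' : (m.map f).comap f = m := Ideal.comap_map_of_surjective' f hf m |>.trans
      (sup_eq_left.mpr hlt.le)
    have hI' : (I.map (mapRingHom f)).comap (mapRingHom f) = I :=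
      (Ideal.comap_map_of_surjective' _ hF I).trans (sup_eq_left.mpr (hker.trans_le hle))
    have hmp : (m.map f).IsPrime := Ideal.map_isPrime_of_surjective hf hlt.le
    have hIp : (I.map (mapRingHom f)).IsPrime :=
      Ideal.map_isPrime_of_surjective hF (hker.trans_le hle)
    have := h (m.map f) hmp (fun h0 ↦ hlt.ne' (by rw [← hm', h0]; rfl)) (fun q hq hqm ↦ ?_)
      (I.map (mapRingHom f)) hIp ?_
    · rw [← hI', ← hker, ← hm', ← hcomap]
      refine this.imp (fun h ↦ ?_) (fun h ↦ ?_)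
      · rw [h]; rfl
      · rw [h]
    · refine (hmin (q.comap f) (hq.comap f) (Ideal.comap_mono bot_le)
        ((Ideal.comap_mono hqm).trans hm'.le)).imp (fun h ↦ ?_) (fun h ↦ ?_)
      · rw [← Ideal.map_comap_of_surjective f hf q, h, Ideal.map_eq_bot_iff_le_ker]
      · rw [← h, Ideal.map_comap_of_surjective f hf q]
    · rw [Ideal.map_le_iff_le_comap, hcomap, hm']
      exact hIm
  · intro h m hm h0 hmin I hI hIm
    have hlt : RingHom.ker f < m.comap f := by
      refine lt_of_le_of_ne (Ideal.comap_mono bot_le) fun h ↦ h0 ?_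
      rw [← Ideal.map_comap_of_surjective f hf m, ← h, Ideal.map_eq_bot_iff_le_ker]
    have := h (m.comap f) (hm.comap f) hlt (fun q hq hk hqm ↦ ?_) (I.comap (mapRingHom f))
      (hI.comap _) ?_ ?_
    · rw [← hcomap, ← hker] at this
      refine this.imp (fun h ↦ ?_) (fun h ↦ ?_)
      · rw [← Ideal.map_comap_of_surjective _ hF I, h, Ideal.map_eq_bot_iff_le_ker]
      · exact Ideal.comap_injective_of_surjective _ hF h
    · have hq' : (q.map f).comap f = q := Ideal.comap_map_of_surjective' f hf q |>.trans
        (sup_eq_left.mpr hk)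
      refine (hmin (q.map f) (Ideal.map_isPrime_of_surjective hf hk)
        (Ideal.map_le_iff_le_comap.mpr hqm)).imp (fun h ↦ ?_) (fun h ↦ ?_)
      · rw [← hq', h]; rfl
      · rw [← hq', h]
    · rw [← hker]; exact Ideal.comap_mono bot_le
    · rw [← hcomap]; exact Ideal.comap_mono hIm

/-- The strong S-property is inherited along surjections. -/
theorem StrongSRing.of_surjective {A B : Type*} [CommRing A] [CommRing B] (h : StrongSRing A)
    (f : A →+* B) (hf : Function.Surjective f) : StrongSRing B := by
  intro p
  let g : A →+* B ⧸ p.asIdeal := (Ideal.Quotient.mk p.asIdeal).comp f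
  have hg : Function.Surjective g := Ideal.Quotient.mk_surjective.comp hf
  have hk : (RingHom.ker g).IsPrime := RingHom.ker_isPrime g
  have : IsSDomain (A ⧸ RingHom.ker g) := h ⟨RingHom.ker g, hk⟩
  rw [isSDomain_iff_of_surjective Ideal.Quotient.mk_surjective] at this
  rw [isSDomain_iff_of_surjective hg]
  simpa only [Ideal.mk_ker] using this

theorem strongSRing_iff {A : Type*} [CommRing A] :
    StrongSRing A ↔ ∀ p m : Ideal A, p.IsPrime → m.IsPrime → p < m →
      (∀ q : Ideal A, q.IsPrime → p ≤ q → q ≤ m → q = p ∨ q = m) →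
      ∀ I : Ideal A[X], I.IsPrime → p.map C ≤ I → I ≤ m.map C → I = p.map C ∨ I = m.map C := by
  have key (p : PrimeSpectrum A) :=
    isSDomain_iff_of_surjective (f := Ideal.Quotient.mk p.asIdeal) Ideal.Quotient.mk_surjective
  simp only [Ideal.mk_ker] at key
  simp only [StrongSRing, key]
  exact ⟨fun h p m hp ↦ h ⟨p, hp⟩ m, fun h p m ↦ h _ m p.2⟩

theorem strongSRing_iff_height {A : Type*} [CommRing A] (hdim : ringKrullDim A ≤ 1) :
    StrongSRing A ↔ ∀ P : PrimeSpectrum A, Order.height P = 1 →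
        ∀ Q : PrimeSpectrum A[X], Q.asIdeal = P.asIdeal.map (C : A →+* A[X]) →
          Order.height Q = 1 := by
  have hdim' : ∀ x : PrimeSpectrum A, IsMin x ∨ IsMax x := Order.krullDim_le_one_iff.mp hdim
  rw [strongSRing_iff]
  constructor
  · intro h P hP Q hQ
    rw [Order.height_eq_one_iff_isMin] at hP ⊢
    have hbot (y : PrimeSpectrum A[X]) (hy : y < Q) :
        y.asIdeal.comap C < P.asIdeal := by
      refine lt_of_le_of_ne ?_ fun h ↦ ?_
      · rw [← P.asIdeal.comap_C_map_C, ← hQ]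
        exact Ideal.comap_mono hy.le
      · refine hy.not_ge ?_
        change Q.asIdeal ≤ y.asIdeal
        rw [hQ, ← h]
        exact Ideal.map_comap_le
    refine ⟨fun hmin ↦ ?_, fun y hy z hz ↦ ?_⟩
    · obtain ⟨p, hp⟩ := not_isMin_iff.mp hP.1
      refine hp.not_ge ?_
      change P.asIdeal ≤ p.asIdeal
      rw [← Ideal.map_C_le_map_C_iff, ← hQ]
      refine @hmin ⟨p.asIdeal.map C, p.2.map_C⟩ ?_
      change p.asIdeal.map C ≤ Q.asIdeal
      rw [hQ]
      exact Ideal.map_mono hp.le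
    · let p : PrimeSpectrum A := ⟨z.asIdeal.comap C, z.2.comap C⟩
      have hpP : p < P := hbot z (lt_of_le_of_lt hz hy)
      have hyC : y.asIdeal.comap C = p.asIdeal :=
        le_antisymm (hP.2 ⟨y.asIdeal.comap C, y.2.comap C⟩ (hbot y hy)
          (show p ≤ _ from Ideal.comap_mono hz)) (Ideal.comap_mono hz)
      have hpz : p.asIdeal.map C ≤ z.asIdeal := Ideal.map_comap_le
      refine ((h p.asIdeal P.asIdeal p.2 P.2 hpP (fun q hq hpq hqP ↦ ?_) y.asIdeal y.2
        (hpz.trans hz) (hQ ▸ hy.le)).resolve_right ?_).le.trans hpz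
      · rcases hqP.lt_or_eq with h' | h'
        · exact .inl (le_antisymm (hP.2 ⟨q, hq⟩ h' (show p ≤ _ from hpq)) hpq)
        · exact .inr h'
      · rw [← hQ]
        exact hy.ne ∘ PrimeSpectrum.ext
  · intro h p m hp hm hlt hcov I hI hpI hIm
    by_contra! hne
    have hm1 : Order.height (⟨m, hm⟩ : PrimeSpectrum A) = 1 := by
      rw [Order.height_eq_one_iff_isMin]
      refine ⟨fun hmin ↦ hlt.not_ge (@hmin ⟨p, hp⟩ hlt.le), fun y hy ↦ ?_⟩
      exact (hdim' y).resolve_right fun hmax ↦ hy.not_ge (hmax hy.le)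
    have := h _ hm1 ⟨m.map C, hm.map_C⟩ rfl
    rw [Order.height_eq_one_iff_isMin] at this
    refine hne.1 (le_antisymm ?_ hpI)
    exact this.2 ⟨I, hI⟩ (show I < m.map C from lt_of_le_of_ne hIm hne.2)
      (show (⟨p.map C, hp.map_C⟩ : PrimeSpectrum A[X]) ≤ _ from hpI)

/-- Elements of a valuation ring are algebraically independent over `A` as soon as their residues
are, provided that quotients of elements of `A` have algebraic residues. -/
theorem ValuationSubring.algebraicIndependent_of_residue {A R L ι : Type*} [CommRing A]
    [CommRing R] [Field L] [Algebra A L] [FaithfulSMul A L] (V : ValuationSubring L)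
    [Algebra R (IsLocalRing.ResidueField V)] {z : ι → V}
    (hz : AlgebraicIndependent R fun i ↦ IsLocalRing.residue V (z i))
    (hres : ∀ (v : V) (a b : A), b ≠ 0 → algebraMap A L b * v = algebraMap A L a →
      IsAlgebraic R (IsLocalRing.residue V v)) :
    AlgebraicIndependent A fun i ↦ (z i : L) := by
  classical
  have : IsDomain R := hz.algebraMap_injective.isDomain
  rw [algebraicIndependent_iff]
  intro p hp
  by_contra hp0
  obtain ⟨d₀, hd₀, hmax⟩ := p.support.exists_max_image
    (fun d ↦ V.valuation (algebraMap A L (p.coeff d))) (MvPolynomial.support_nonempty.mpr hp0)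
  have hc : p.coeff d₀ ≠ 0 := MvPolynomial.mem_support_iff.mp hd₀
  have hcL : algebraMap A L (p.coeff d₀) ≠ 0 := by
    rwa [Ne, FaithfulSMul.algebraMap_eq_zero_iff]
  have hmem (d) : algebraMap A L (p.coeff d) / algebraMap A L (p.coeff d₀) ∈ V := by
    rw [← V.valuation_le_one_iff, map_div₀]
    by_cases hd : d ∈ p.support
    · exact div_le_one_of_le₀ (hmax d hd) zero_le
    · simp [MvPolynomial.notMem_support_iff.mp hd]
  let u (d) : V := ⟨_, hmem d⟩
  have hu (d) : IsAlgebraic R (IsLocalRing.residue V (u d)) :=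
    hres (u d) (p.coeff d) (p.coeff d₀) hc (mul_div_cancel₀ _ hcL)
  have hu' (d) : IsLocalRing.residue V (u d) ∈
      Subalgebra.algebraicClosure R (IsLocalRing.ResidueField V) := hu d
  let q : MvPolynomial ι (Subalgebra.algebraicClosure R (IsLocalRing.ResidueField V)) :=
    ∑ d ∈ p.support, MvPolynomial.monomial d ⟨_, hu' d⟩
  have hsum : ∑ d ∈ p.support, u d * d.prod (fun i k ↦ z i ^ k) = 0 := by
    apply Subtype.ext
    refine (map_sum V.subtype _ _).trans ?_
    rw [MvPolynomial.aeval_def, MvPolynomial.eval₂_eq] at hp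
    rw [ZeroMemClass.coe_zero, ← zero_div (algebraMap A L (p.coeff d₀)), ← hp, Finset.sum_div]
    refine Finset.sum_congr rfl fun d _ ↦ ?_
    rw [map_mul, Finsupp.prod, map_prod, mul_div_right_comm]
    simp only [map_pow]
    rfl
  have hq : q = 0 := by
    refine (algebraicIndependent_iff.mp hz.subalgebraAlgebraicClosure) q ?_
    have := congr(IsLocalRing.residue V $hsum)
    simpa [q, MvPolynomial.aeval_monomial, Finsupp.prod, Subalgebra.algebraMap_def] using this
  have h1 : q.coeff d₀ = 1 := by
    have hu1 : u d₀ = 1 := Subtype.ext (div_self hcL)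
    simp only [q, MvPolynomial.coeff_sum, MvPolynomial.coeff_monomial]
    rw [Finset.sum_ite_eq', if_pos hd₀]
    exact Subtype.ext (by simp [hu1])
  simp [hq] at h1

/-- Let `m` be a prime such that `m[X]` contains no nonzero prime lying over zero. A family whose
image under a ring homomorphism is algebraically independent over `A ⧸ m` is algebraically
independent over `A`. -/
theorem AlgebraicIndependent.of_ringHom_quotient {A E F ι : Type*} [CommRing A] [IsDomain A]
    [CommRing E] [IsDomain E] [CommRing F] [IsDomain F] [Algebra A E] [FaithfulSMul A E]
    {m : Ideal A} [Algebra (A ⧸ m) F] (g : E →+* F)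
    (hg : ∀ a, g (algebraMap A E a) = algebraMap (A ⧸ m) F (Ideal.Quotient.mk m a))
    (hm : ∀ J : Ideal A[X], J.IsPrime → J ≤ m.map C → J.comap C = ⊥ → J = ⊥)
    {z : ι → E} (hz : AlgebraicIndependent (A ⧸ m) (g ∘ z)) : AlgebraicIndependent A z := by
  let P := RingHom.ker g
  let L := FractionRing E
  have hP : P.IsPrime := RingHom.ker_isPrime g
  have hunit (y : P.primeCompl) : IsUnit (algebraMap E L y) := by
    rw [isUnit_iff_ne_zero, Ne, FaithfulSMul.algebraMap_eq_zero_iff]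
    rintro h
    exact y.2 (h ▸ P.zero_mem)
  obtain ⟨V, hV, hloc⟩ := IsLocalRing.exists_factor_valuationRing
    (IsLocalization.lift (S := Localization.AtPrime P) hunit)
  let θ : E →+* V := (RingHom.codRestrict _ V.toSubring hV).comp (algebraMap E _)
  have hθ (e : E) : (θ e : L) = algebraMap E L e := IsLocalization.lift_eq hunit e
  let r : E →+* IsLocalRing.ResidueField V := (IsLocalRing.residue V).comp θ
  have hr (e : E) : r e = 0 ↔ g e = 0 := by
    change IsLocalRing.residue V (θ e) = 0 ↔ e ∈ P
    rw [IsLocalRing.residue_eq_zero_iff, IsLocalRing.mem_maximalIdeal, mem_nonunits_iff,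
      ← IsLocalization.AtPrime.to_map_mem_maximal_iff (Localization.AtPrime P) P,
      IsLocalRing.mem_maximalIdeal, mem_nonunits_iff, not_iff_not]
    exact isUnit_map_iff (RingHom.codRestrict _ V.toSubring hV) _
  let _ : Algebra (A ⧸ m) (IsLocalRing.ResidueField V) :=
    (Ideal.Quotient.lift m (r.comp (algebraMap A E)) fun a ha ↦ by
      rw [RingHom.comp_apply, hr, hg, Ideal.Quotient.eq_zero_iff_mem.mpr ha, map_zero]).toAlgebra
  have halg (a : A) : algebraMap (A ⧸ m) (IsLocalRing.ResidueField V) (Ideal.Quotient.mk m a) =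
      r (algebraMap A E a) := rfl
  have hL : AlgebraicIndependent A fun i ↦ ((θ (z i) : V) : L) := by
    refine V.algebraicIndependent_of_residue (R := A ⧸ m) ?_ fun v a b hb hv ↦ ?_
    · rw [algebraicIndependent_iff] at hz ⊢
      intro p hp
      obtain ⟨p, rfl⟩ := MvPolynomial.map_surjective _ Ideal.Quotient.mk_surjective p
      refine hz _ ?_
      have h1 : MvPolynomial.aeval (g ∘ z) (MvPolynomial.map (Ideal.Quotient.mk m) p) =
          g (MvPolynomial.aeval z p) := by
        rw [MvPolynomial.aeval_def, MvPolynomial.eval₂_map, MvPolynomial.aeval_def,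
          MvPolynomial.hom_eval₂]
        congr 1
        ext a
        exact (hg a).symm
      rw [h1, ← hr, ← hp, MvPolynomial.aeval_def, MvPolynomial.aeval_def, MvPolynomial.eval₂_map,
        MvPolynomial.hom_eval₂]
      rfl
    · let J := RingHom.ker (aeval (R := A) (v : L))
      have hJ : J.comap C = ⊥ := by
        refine (Submodule.eq_bot_iff _).mpr fun x hx ↦ ?_
        simpa [J, Ideal.mem_comap] using hx
      have hJ0 : J ≠ ⊥ := by
        intro h
        have : C b * X - C a ∈ J := by simp [J, hv]
        rw [h, Ideal.mem_bot] at this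
        exact hb (by simpa using congr(coeff $this 1))
      have hJm : ¬ J ≤ m.map C := fun h ↦ hJ0 (hm J (RingHom.ker_isPrime _) h hJ)
      obtain ⟨h, hhJ, hhm⟩ := SetLike.not_le_iff_exists.mp hJm
      refine ⟨h.map (Ideal.Quotient.mk m), ?_, ?_⟩
      · rwa [Ne, ← coe_mapRingHom, ← RingHom.mem_ker, ker_mapRingHom, Ideal.mk_ker]
      · have h1 : h.eval₂ (θ.comp (algebraMap A E)) v = 0 := by
          apply Subtype.ext
          change V.subtype _ = 0
          rw [hom_eval₂]
          refine Eq.trans ?_ hhJ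
          change _ = eval₂ _ _ _
          congr 1
          ext a
          exact (hθ _).trans (IsScalarTower.algebraMap_apply A E L a).symm
        rw [aeval_def, eval₂_map]
        have := congr(IsLocalRing.residue V $h1)
        rw [hom_eval₂, map_zero] at this
        exact this
  simp only [hθ] at hL
  exact hL.of_comp (IsScalarTower.toAlgHom A E L)

/-- A prime which is both minimal and maximal in its fibre is quasi-finite. -/
theorem Algebra.QuasiFiniteAt.of_isolated {R S : Type*} [CommRing R] [CommRing S] [Algebra R S]
    [Algebra.FiniteType R S] (q : PrimeSpectrum S)
    (h : ∀ q' : PrimeSpectrum S, q'.comap (algebraMap R S) = q.comap (algebraMap R S) →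
      q' ≤ q ∨ q ≤ q' → q' = q) : Algebra.QuasiFiniteAt R q.asIdeal := by
  refine .of_isOpen_singleton_fiber q ?_
  let p := q.comap (algebraMap R S)
  let e := PrimeSpectrum.preimageHomeomorphFiber R S p
  let x := e ⟨q, rfl⟩
  have hx (y : PrimeSpectrum (p.asIdeal.Fiber S)) (hy : y ≤ x ∨ x ≤ y) : y = x := by
    let o := PrimeSpectrum.preimageOrderIsoFiber R S p
    obtain ⟨q', rfl⟩ := o.surjective y
    exact congr(o $(Subtype.ext (h q' q'.2 (hy.imp o.le_iff_le.mp o.le_iff_le.mp))))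
  have : IsNoetherianRing (p.asIdeal.Fiber S) :=
    Algebra.FiniteType.isNoetherianRing p.asIdeal.ResidueField _
  have : IsJacobsonRing (p.asIdeal.Fiber S) :=
    isJacobsonRing_of_finiteType (A := p.asIdeal.ResidueField)
  have := PrimeSpectrum.isOpen_singleton_tfae_of_isNoetherian_of_isJacobsonRing x
  rw [← e.isOpen_image, Set.image_singleton]
  refine (this.out 0 2 rfl rfl).mpr ⟨?_, ?_⟩
  · rw [PrimeSpectrum.isClosed_singleton_iff_isMaximal]
    obtain ⟨M, hM, hle⟩ := x.asIdeal.exists_le_maximal x.2.ne_top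
    have := hx ⟨M, hM.isPrime⟩ (.inr hle)
    exact this ▸ hM
  · rintro _ y hy rfl
    exact hx y (.inl ((PrimeSpectrum.le_iff_specializes _ _).mpr hy))

theorem Algebra.IsAlgebraic.of_quasiFiniteAt {R S : Type*} [CommRing R] [CommRing S] [IsDomain S]
    [Algebra R S] [FaithfulSMul R S] [Algebra.FiniteType R S] (q : Ideal S) [q.IsPrime]
    [Algebra.QuasiFiniteAt R q] : Algebra.IsAlgebraic R S := by
  have : IsDomain R := (FaithfulSMul.algebraMap_injective R S).isDomain
  obtain ⟨r, hr, H⟩ := Algebra.zariskisMainProperty_iff'.mp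
    (Algebra.ZariskisMainProperty.of_finiteType (R := R) q)
  have hr0 : r ≠ 0 := fun h ↦ hr (h ▸ q.zero_mem)
  have hralg : IsAlgebraic R r := by
    obtain ⟨m, hm⟩ := H r
    rw [← pow_succ] at hm
    exact hm.isAlgebraic.of_pow m.succ_pos
  refine ⟨fun x ↦ ?_⟩
  obtain ⟨m, hm⟩ := H x
  exact (hralg.pow m).of_mul (pow_mem (mem_nonZeroDivisors_of_ne_zero hr0) m) hm.isAlgebraic

open IsLocalization in
attribute [local instance] Polynomial.algebra Polynomial.isLocalization in
theorem Polynomial.height_map_C_of_isNoetherianRing_localization {R : Type*} [CommRing R]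
    (q : Ideal R) [q.IsPrime] [IsNoetherianRing (Localization.AtPrime q)] :
    (q.map (C : R →+* R[X])).height = q.height := by
  let L := Localization.AtPrime q
  have hmax : (q.map (algebraMap R L)).IsMaximal := by
    rw [Localization.AtPrime.map_eq_maximalIdeal]
    exact IsLocalRing.maximalIdeal.isMaximal L
  have hqC : (q.map (C : R →+* R[X])).IsPrime := Ideal.isPrime_map_C_of_isPrime
  have disj : Disjoint (q.primeCompl.map C : Set R[X]) (q.map (C : R →+* R[X])) := by
    refine Set.disjoint_left.mpr fun a ⟨b, hb⟩ ha ↦ hb.1 ?_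
    rw [← hb.2] at ha
    simpa using Ideal.mem_map_C_iff.mp ha 0
  have h1 : (q.map (algebraMap R L)).height = q.height := by
    rw [height_map_of_disjoint q.primeCompl]
    exact Disjoint.symm <| Set.disjoint_left.mpr fun _ a b ↦ b a
  have h2 := height_map_of_disjoint (S := L[X]) (Submonoid.map C q.primeCompl) _ disj
  rw [← h1, ← h2, ← Polynomial.height_map_C (q.map (algebraMap R L)), Ideal.map_map, Ideal.map_map]
  congr 2
  ext
  simp

theorem Localization.AtPrime.isNoetherianRing_of_under_eq_bot {A B : Type*} [CommRing A]
    [IsDomain A] [CommRing B] [Algebra A B] [Algebra.FiniteType A B] (q : Ideal B) [q.IsPrime]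
    (h : q.under A = ⊥) : IsNoetherianRing (Localization.AtPrime q) := by
  let L := Localization.AtPrime q
  have hunit (a : nonZeroDivisors A) : IsUnit (algebraMap A L a) := by
    rw [IsScalarTower.algebraMap_apply A B L]
    refine IsLocalization.map_units L (⟨_, fun ha ↦ ?_⟩ : q.primeCompl)
    exact nonZeroDivisors.ne_zero a.2 ((Ideal.mem_bot (R := A)).mp (h ▸ Ideal.mem_comap.mpr ha))
  let _ : Algebra (FractionRing A) L := (IsLocalization.lift hunit).toAlgebra
  have : IsScalarTower A (FractionRing A) L :=
    .of_algebraMap_eq fun a ↦ (IsLocalization.lift_eq hunit a).symm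
  have : Algebra.EssFiniteType B L := .of_isLocalization L q.primeCompl
  have : Algebra.EssFiniteType A L := .comp A B L
  have : Algebra.EssFiniteType (FractionRing A) L := .of_comp A _ _
  exact Algebra.EssFiniteType.isNoetherianRing (FractionRing A) L

/-- If `q` is minimal among the primes in its fibre, then `B` is algebraic over the subalgebra
generated by any lift of a transcendence basis of `B ⧸ q`. -/
theorem exists_algebraicIndependent_quotient_isAlgebraic_adjoin.{u, v} {A : Type u}
    {B : Type v} [CommRing A] [CommRing B] [IsDomain B] [Algebra A B] [Algebra.FiniteType A B]
    (q : Ideal B) [q.IsPrime]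
    (h : ∀ q' : Ideal B, q'.IsPrime → q'.under A = q.under A → q' ≤ q → q' = q) :
    ∃ (ι : Type v) (y : ι → B),
      AlgebraicIndependent (A ⧸ q.under A) (Ideal.Quotient.mk q ∘ y) ∧
      Algebra.IsAlgebraic (Algebra.adjoin A (Set.range y)) B := by
  obtain ⟨ι, x, hx⟩ := exists_isTranscendenceBasis' (A ⧸ q.under A) (B ⧸ q)
  choose y hy using fun i ↦ Ideal.Quotient.mk_surjective (x i)
  have hxy : Ideal.Quotient.mk q ∘ y = x := funext hy
  refine ⟨ι, y, hxy ▸ hx.1, ?_⟩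
  set R := Algebra.adjoin A (Set.range y)
  have : Algebra.FiniteType R B := .of_restrictScalars_finiteType A R B
  have hlift (r : B ⧸ q) (hr : r ∈ Algebra.adjoin (A ⧸ q.under A) (Set.range x)) :
      ∃ s ∈ R, Ideal.Quotient.mk q s = r := by
    induction hr using Algebra.adjoin_induction with
    | mem _ hr =>
      obtain ⟨i, rfl⟩ := hr
      exact ⟨y i, Algebra.subset_adjoin ⟨i, rfl⟩, hy i⟩
    | algebraMap a =>
      obtain ⟨a, rfl⟩ := Ideal.Quotient.mk_surjective a
      exact ⟨algebraMap A B a, R.algebraMap_mem a, rfl⟩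
    | add r r' _ _ hr hr' =>
      obtain ⟨s, hs, rfl⟩ := hr
      obtain ⟨s', hs', rfl⟩ := hr'
      exact ⟨s + s', add_mem hs hs', map_add _ _ _⟩
    | mul r r' _ _ hr hr' =>
      obtain ⟨s, hs, rfl⟩ := hr
      obtain ⟨s', hs', rfl⟩ := hr'
      exact ⟨s * s', mul_mem hs hs', map_mul _ _ _⟩
  have hqf : Algebra.QuasiFiniteAt R q := by
    refine Algebra.QuasiFiniteAt.of_isolated (⟨q, ‹_›⟩ : PrimeSpectrum B) fun q' hq' hle ↦ ?_
    have hmem (s : B) (hs : s ∈ R) : s ∈ q'.asIdeal ↔ s ∈ q :=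
      SetLike.ext_iff.mp congr($(hq').asIdeal) (⟨s, hs⟩ : R)
    refine PrimeSpectrum.ext ?_
    rcases hle with hle | hle
    · exact h _ q'.2 (Ideal.ext fun a ↦ hmem _ (R.algebraMap_mem a)) hle
    · refine le_antisymm (fun c hc ↦ ?_) hle
      by_contra hcq
      have hcalg := hx.isAlgebraic.isAlgebraic (Ideal.Quotient.mk q c)
      obtain ⟨⟨r, hr⟩, hr0, hdvd⟩ := hcalg.exists_nonzero_dvd
        (mem_nonZeroDivisors_of_ne_zero (by rwa [Ne, Ideal.Quotient.eq_zero_iff_mem]))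
      obtain ⟨s, hs, rfl⟩ := hlift r hr
      obtain ⟨d, hd⟩ := hdvd
      obtain ⟨d, rfl⟩ := Ideal.Quotient.mk_surjective d
      have hd' : s - c * d ∈ q := Ideal.Quotient.eq.mp (hd.trans (map_mul _ _ _).symm)
      have hs' : s ∈ q'.asIdeal := by
        rw [← sub_add_cancel s (c * d)]
        exact add_mem (hle hd') (Ideal.mul_mem_right _ _ hc)
      exact hr0 (Subtype.ext (Ideal.Quotient.eq_zero_iff_mem.mpr ((hmem s hs).mp hs')))
  exact .of_quasiFiniteAt q

/-- A domain of finite type over an S-domain of dimension at most one is an S-domain. -/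
theorem IsSDomain.of_finiteType {A B : Type*} [CommRing A] [IsDomain A] [CommRing B] [IsDomain B]
    [Algebra A B] [FaithfulSMul A B] [Algebra.FiniteType A B] (hA : IsSDomain A)
    (hdim : ringKrullDim A ≤ 1) : IsSDomain B := by
  rw [isSDomain_iff]
  intro q hq hq0 hmin I hI hIq
  by_cases hm0 : q.under A = ⊥
  · have := Localization.AtPrime.isNoetherianRing_of_under_eq_bot q hm0
    have h1 := (PrimeSpectrum.height_eq_one_iff_of_isDomain ⟨q, hq⟩).mpr ⟨hq0, hmin⟩
    have h2 := Polynomial.height_map_C_of_isNoetherianRing_localization q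
    have hqC : (q.map (C : B →+* B[X])).IsPrime := hq.map_C
    have h3 : Order.height (⟨q.map C, hqC⟩ : PrimeSpectrum B[X]) = 1 := by
      rw [← h1, ← PrimeSpectrum.height_eq_orderHeight, ← PrimeSpectrum.height_eq_orderHeight]
      exact h2
    exact ((PrimeSpectrum.height_eq_one_iff_of_isDomain _).mp h3).2 I hI hIq
  by_contra! hne
  have hdim' : ∀ x : PrimeSpectrum A, IsMin x ∨ IsMax x := Order.krullDim_le_one_iff.mp hdim
  have hIB : I.comap C = ⊥ := by
    refine (hmin _ (hI.comap C) ?_).resolve_right fun h ↦ hne.2 (le_antisymm hIq ?_)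
    · rw [← q.comap_C_map_C]
      exact Ideal.comap_mono hIq
    · rw [← h]
      exact Ideal.map_comap_le
  have hm (J : Ideal A[X]) (hJ : J.IsPrime) (hle : J ≤ (q.under A).map C) (hJA : J.comap C = ⊥) :
      J = ⊥ := by
    refine (isSDomain_iff.mp hA (q.under A) inferInstance hm0 (fun p hp hpq ↦ ?_) J hJ
      hle).resolve_right fun h ↦ hm0 ?_
    · refine (hdim' ⟨p, hp⟩).imp (fun h ↦ ?_) (fun h ↦ ?_)
      · rw [isMin_iff_eq_bot] at h
        exact congr($(h).asIdeal)
      · exact le_antisymm hpq (h (show _ ≤ (⟨q.under A, inferInstance⟩ : PrimeSpectrum A) from hpq))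
    · rw [← (q.under A).comap_C_map_C, ← h, hJA]
  obtain ⟨ι, y, hy, halg⟩ := exists_algebraicIndependent_quotient_isAlgebraic_adjoin (A := A) q
    fun q' hq' h hle ↦ (hmin q' hq' hle).resolve_left fun h0 ↦ hm0 <| by
      rw [← h, h0, Ideal.under_bot]
  let E := B[X] ⧸ I
  let g : E →+* (B ⧸ q)[X] := Ideal.Quotient.lift I (mapRingHom (Ideal.Quotient.mk q))
    fun f hf ↦ by
      rw [← RingHom.mem_ker, ker_mapRingHom, Ideal.mk_ker]
      exact hIq hf
  have hBE : Function.Injective (algebraMap B E) := by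
    rw [injective_iff_map_eq_zero]
    intro b hb
    have : C b ∈ I := Ideal.Quotient.eq_zero_iff_mem.mp hb
    rwa [← Ideal.mem_comap, hIB] at this
  have : FaithfulSMul B E := (faithfulSMul_iff_algebraMap_injective _ _).mpr hBE
  have : FaithfulSMul A E := .trans A B E
  let X' : E := Ideal.Quotient.mk I X
  have hz : AlgebraicIndependent (A ⧸ q.under A)
      (g ∘ Sum.elim (fun _ : Unit ↦ X') (algebraMap B E ∘ y)) := by
    have := hy.sumElim_comp (IsTranscendenceBasis.polynomial Unit (B ⧸ q)).1
    convert this using 1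
    ext i : 1
    rcases i with i | i
    · exact map_X _
    · simp only [Function.comp_apply, Sum.elim_inr, algebraMap_eq]
      exact map_C _
  have hX := (AlgebraicIndependent.sumElim_iff.mp
    (AlgebraicIndependent.of_ringHom_quotient g (fun a ↦ map_C _) hm hz)).2
  have hXalg : IsAlgebraic B X' := by
    obtain ⟨f, hf, hf0⟩ := Submodule.exists_mem_ne_zero_of_ne_bot hne.1
    refine ⟨f, hf0, ?_⟩
    have : aeval X' f = Ideal.Quotient.mk I f := by
      rw [aeval_def]
      exact (hom_eval₂ f C (Ideal.Quotient.mk I) X).symm.trans (congrArg _ eval₂_C_X)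
    rw [this, Ideal.Quotient.eq_zero_iff_mem]
    exact hf
  replace hXalg := hXalg.restrictScalars (Algebra.adjoin A (Set.range y))
  let R := Algebra.adjoin A (Set.range y)
  let S := Algebra.adjoin A (Set.range (algebraMap B E ∘ y))
  have hRS (r : R) : algebraMap B E r ∈ S := by
    have : Subalgebra.map (IsScalarTower.toAlgHom A B E) R = S := by
      rw [AlgHom.map_adjoin, ← Set.range_comp]
      rfl
    rw [← this]
    exact ⟨r, r.2, rfl⟩
  let φ : R →+* S := ((algebraMap B E).comp R.val.toRingHom).codRestrict S hRS
  let _ : Algebra R S := φ.toAlgebra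
  have : IsScalarTower R S E :=
    IsScalarTower.of_algebraMap_eq (R := R) (S := S) (A := E) fun _ ↦ rfl
  refine algebraicIndependent_unique_type_iff.mp hX (hXalg.extendScalars fun a b hab ↦ ?_)
  exact Subtype.ext (hBE congr($(hab).1))

/-- An algebra of finite type over a strong S-ring of dimension at most one is a strong
S-ring. -/
theorem StrongSRing.of_finiteType {A B : Type*} [CommRing A] [CommRing B] [Algebra A B]
    [Algebra.FiniteType A B] (hA : StrongSRing A) (hdim : ringKrullDim A ≤ 1) :
    StrongSRing B := by
  intro P
  have : Algebra.FiniteType (A ⧸ P.asIdeal.under A) (B ⧸ P.asIdeal) :=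
    .of_restrictScalars_finiteType A _ _
  refine IsSDomain.of_finiteType (A := A ⧸ P.asIdeal.under A)
    (hA ⟨P.asIdeal.under A, inferInstance⟩) ?_
  exact (ringKrullDim_le_of_surjective _ Ideal.Quotient.mk_surjective).trans hdim

theorem StrongSRing.stablyStrongSRing {A : Type*} [CommRing A] (hA : StrongSRing A)
    (hdim : ringKrullDim A ≤ 1) : StablyStrongSRing A :=
  fun _ _ ↦ hA.of_finiteType hdim

/-- For a one-dimensional ring `A`: stably strong S-ring ↔ strong
S-ring ↔ every height-one prime `P` satisfies `ht (P[X]) = 1`. -/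
theorem stmt5 {A : Type*} [CommRing A] (hdim : ringKrullDim A = 1) :
    (StablyStrongSRing A ↔ StrongSRing A) ∧
    (StrongSRing A ↔
      ∀ P : PrimeSpectrum A, Order.height P = 1 →
        ∀ Q : PrimeSpectrum A[X], Q.asIdeal = P.asIdeal.map (C : A →+* A[X]) →
          Order.height Q = 1) := by
  refine ⟨⟨fun h ↦ ?_, fun h ↦ h.stablyStrongSRing hdim.le⟩, strongSRing_iff_height hdim.le⟩
  refine (h 1 one_pos).of_surjective MvPolynomial.constantCoeff fun a ↦ ⟨MvPolynomial.C a, ?_⟩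
  exact MvPolynomial.constantCoeff_C _ a
end

section
/- Let A and B be integrally closed domains that are algebras over a field k. Then the minimal prime ideals of A ⊗_k B are pairwise comaximal. -/
open Polynomial TensorProduct

/-- Over an algebraically closed field, points of a finitely generated domain avoid any given
proper hypersurface. -/
lemma IsAlgClosed.exists_algHom_apply_ne_zero (Ω : Type*) {D : Type*} [Field Ω] [IsAlgClosed Ω]
    [CommRing D] [IsDomain D] [Algebra Ω D] [Algebra.FiniteType Ω D] {d : D} (hd : d ≠ 0) :
    ∃ φ : D →ₐ[Ω] Ω, φ d ≠ 0 := by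
  have : IsJacobsonRing D := isJacobsonRing_of_finiteType (A := Ω)
  have hj : (⊥ : Ideal D).jacobson = ⊥ := by
    rw [← Ideal.radical_eq_jacobson]
    exact Ideal.IsPrime.radical Ideal.isPrime_bot
  have hd' : d ∉ (⊥ : Ideal D).jacobson := by simpa [hj] using hd
  simp only [Ideal.jacobson, Ideal.mem_sInf, not_forall] at hd'
  obtain ⟨m, ⟨-, hm⟩, hdm⟩ := hd'
  let : Field (D ⧸ m) := Ideal.Quotient.field m
  have : Module.Finite Ω (D ⧸ m) := finite_of_finite_type_of_isJacobsonRing Ω (D ⧸ m)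
  let e := AlgEquiv.ofBijective (Algebra.ofId Ω (D ⧸ m))
    (IsAlgClosed.algebraMap_bijective_of_isIntegral (k := Ω))
  refine ⟨e.symm.toAlgHom.comp (Ideal.Quotient.mkₐ Ω m), ?_⟩
  simpa [Ideal.Quotient.eq_zero_iff_mem] using hdm

lemma isDomain_tensorProduct_of_isAlgClosed (Ω D E : Type*) [Field Ω] [IsAlgClosed Ω]
    [CommRing D] [IsDomain D] [Algebra Ω D] [CommRing E] [IsDomain E] [Algebra Ω E] :
    IsDomain (D ⊗[Ω] E) := by
  have : Nontrivial (D ⊗[Ω] E) :=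
    Algebra.TensorProduct.nontrivial_of_algebraMap_injective_of_isDomain Ω D E
      (algebraMap Ω D).injective (algebraMap Ω E).injective
  have : NoZeroDivisors (D ⊗[Ω] E) := by
    refine ⟨fun {x y} hxy ↦ ?_⟩
    have hmap (A B : Subalgebra Ω D) (h : A ≤ B) (z : A ⊗[Ω] E) :
        Algebra.TensorProduct.map B.val (AlgHom.id Ω E)
          (Algebra.TensorProduct.map (Subalgebra.inclusion h) (AlgHom.id Ω E) z) =
        LinearMap.rTensor E A.val.toLinearMap z := by
      induction z with
      | zero => simp
      | add x y hx hy => simp only [map_add, hx, hy]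
      | tmul a e => rfl
    obtain ⟨A, hA, ⟨x, rfl⟩, ⟨y, rfl⟩⟩ : ∃ A : Subalgebra Ω D, A.FG ∧
        x ∈ (Algebra.TensorProduct.map A.val (AlgHom.id Ω E)).range ∧
        y ∈ (Algebra.TensorProduct.map A.val (AlgHom.id Ω E)).range := by
      obtain ⟨A, hA, x', hx⟩ := TensorProduct.Algebra.exists_of_fg x
      obtain ⟨B, hB, y', hy⟩ := TensorProduct.Algebra.exists_of_fg y
      refine ⟨A ⊔ B, hA.sup hB, ?_, ?_⟩
      · rw [← hx]
        exact ⟨_, hmap A (A ⊔ B) le_sup_left x'⟩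
      · rw [← hy]
        exact ⟨_, hmap B (A ⊔ B) le_sup_right y'⟩
    by_contra! hne
    have := A.fg_iff_finiteType.mp hA
    have hinj : Function.Injective (Algebra.TensorProduct.map A.val (AlgHom.id Ω E)).toRingHom :=
      Module.Flat.rTensor_preserves_injective_linearMap A.val.toLinearMap Subtype.val_injective
    rw [← map_mul, map_eq_zero_iff _ hinj] at hxy
    replace hne : x ≠ 0 ∧ y ≠ 0 := ⟨fun h ↦ hne.1 (by simp [h]), fun h ↦ hne.2 (by simp [h])⟩
    let b := Module.Free.chooseBasis Ω E
    have key (x : A ⊗[Ω] E) (hx : x ≠ 0) : ∃ a : A, a ≠ 0 ∧ ∀ φ : A →ₐ[Ω] Ω, φ a ≠ 0 →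
        Algebra.TensorProduct.lift ((Algebra.ofId Ω E).comp φ) (AlgHom.id Ω E)
          (fun _ _ ↦ .all _ _) x ≠ 0 := by
      let c := Algebra.TensorProduct.basis A b
      obtain ⟨i, hi⟩ : ∃ i, c.repr x i ≠ 0 := by
        by_contra! h
        exact hx (c.repr.map_eq_zero_iff.mp (Finsupp.ext h))
      refine ⟨_, hi, fun φ hφ h ↦ hφ ?_⟩
      have : ∀ x, b.repr (Algebra.TensorProduct.lift ((Algebra.ofId Ω E).comp φ) (AlgHom.id Ω E)
          (fun _ _ ↦ .all _ _) x) i = φ (c.repr x i) := by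
        intro x
        induction x with
        | zero => simp
        | add x y hx hy => simp [hx, hy]
        | tmul a e =>
          rw [Algebra.TensorProduct.lift_tmul, AlgHom.comp_apply, Algebra.ofId_apply,
            ← Algebra.smul_def]
          simp [c, Algebra.TensorProduct.basis_repr_tmul]
      rw [← this, h]; simp
    obtain ⟨a, ha, ha'⟩ := key x hne.1
    obtain ⟨c, hc, hc'⟩ := key y hne.2
    obtain ⟨φ, hφ⟩ := IsAlgClosed.exists_algHom_apply_ne_zero Ω (mul_ne_zero ha hc)
    rw [map_mul] at hφ
    refine mul_ne_zero (ha' φ (left_ne_zero_of_mul hφ)) (hc' φ (right_ne_zero_of_mul hφ)) ?_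
    rw [← map_mul, hxy, map_zero]
  exact NoZeroDivisors.to_isDomain _

lemma natDegree_minpoly_eq_of_isSeparable {F K M : Type*} [Field F] [Field K] [Field M]
    [Algebra F K] [Algebra K M] [Algebra F M] [IsScalarTower F K M] [IsAlgClosed M]
    (h : separableClosure F K = ⊥) {x : M} (hx : IsSeparable F x) :
    (minpoly K x).natDegree = (minpoly F x).natDegree := by
  have hdvd := minpoly.dvd_map_of_isScalarTower F K x
  have hxK : IsIntegral K x := hx.isIntegral.tower_top
  have hroots : ∀ a ∈ ((minpoly K x).map (algebraMap K M)).roots,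
      a ∈ (algebraMap (separableClosure F M) M).range := by
    intro a ha
    have ha' : aeval a (minpoly K x) = 0 := by
      rw [mem_roots (Polynomial.map_ne_zero (minpoly.ne_zero hxK))] at ha
      simpa [aeval_def, eval_map] using ha
    have ha'' : aeval a (minpoly F x) = 0 := by
      have := aeval_eq_zero_of_dvd_aeval_eq_zero hdvd ha'
      simpa using this
    exact ⟨⟨a, mem_separableClosure_iff.mpr (hx.of_dvd (minpoly.dvd F a ha''))⟩, rfl⟩
  have hl := (IsAlgClosed.splits _).mem_lift_of_roots_mem_range
    ((minpoly.monic hxK).map (algebraMap K M)) _ hroots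
  have hlF : minpoly K x ∈ lifts (algebraMap F K) := by
    rw [lifts_iff_coeff_lifts]
    intro n
    obtain ⟨c, hc⟩ := (lifts_iff_coeff_lifts _).mp hl n
    rw [coeff_map] at hc
    have : (minpoly K x).coeff n ∈ separableClosure F K := by
      rw [← map_mem_separableClosure_iff (IsScalarTower.toAlgHom F K M)]
      rw [IsScalarTower.toAlgHom_apply, ← hc]
      exact c.2
    rw [h] at this
    exact IntermediateField.mem_bot.mp this
  obtain ⟨g, hg, hgd, hgm⟩ := lifts_and_natDegree_eq_and_monic hlF (minpoly.monic hxK)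
  apply le_antisymm
  · have := natDegree_le_of_dvd hdvd (Polynomial.map_ne_zero (minpoly.ne_zero hx.isIntegral))
    simpa using this
  · rw [← hgd]
    apply natDegree_le_of_dvd _ hgm.ne_zero
    apply minpoly.dvd
    rw [← aeval_map_algebraMap K, hg, minpoly.aeval]

lemma isDomain_tensorProduct_of_isSeparable (F K S : Type*) [Field F] [Field K] [Field S]
    [Algebra F K] [Algebra F S] [Algebra.IsSeparable F S] (h : separableClosure F K = ⊥) :
    IsDomain (K ⊗[F] S) := by
  let M := AlgebraicClosure K
  let f : S →ₐ[F] M := IsAlgClosed.lift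
  let A := f.fieldRange
  have hA : ∀ x ∈ A, IsSeparable F x := by
    rintro _ ⟨x, rfl⟩
    exact (Algebra.IsSeparable.isSeparable F x).map f f.injective
  have hAK : A.LinearDisjoint K := by
    refine Submodule.LinearDisjoint.of_linearDisjoint_fg_left _ _ fun N hN hfg ↦ ?_
    obtain ⟨s, hs⟩ := hfg
    have hsA : (s : Set M) ⊆ A := (Submodule.span_le.mp hs.le).trans hN
    have : FiniteDimensional F (IntermediateField.adjoin F (s : Set M)) :=
      IntermediateField.finiteDimensional_adjoin fun x hx ↦ (hA x (hsA hx)).isIntegral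
    have : Algebra.IsSeparable F (IntermediateField.adjoin F (s : Set M)) :=
      (IntermediateField.isSeparable_adjoin_iff_isSeparable F M).mpr fun x hx ↦ hA x (hsA hx)
    let G := IntermediateField.adjoin F (s : Set M)
    let b := Field.powerBasisOfFiniteOfSeparable F G
    have hdim : (minpoly K (b.gen : M)).natDegree = b.dim := by
      rw [natDegree_minpoly_eq_of_isSeparable h, ← b.natDegree_minpoly]
      · exact congrArg natDegree (minpoly.algebraMap_eq (algebraMap G M).injective b.gen)
      · exact (Algebra.IsSeparable.isSeparable F b.gen).map G.val G.val.injective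
    have hGK : G.LinearDisjoint K := by
      refine IntermediateField.LinearDisjoint.of_basis_left b.basis ?_
      have := (linearIndependent_pow (K := K) (b.gen : M)).comp (Fin.cast hdim.symm)
        (Fin.cast_injective _)
      convert this using 1
      ext i
      simp
    refine Submodule.LinearDisjoint.of_le_left_of_flat hGK ?_
    rw [← hs, Submodule.span_le]
    exact IntermediateField.subset_adjoin F _
  have := hAK.isDomain
  exact ((Algebra.TensorProduct.congr AlgEquiv.refl (AlgEquiv.ofInjectiveField f)).trans
    (Algebra.TensorProduct.comm F K A)).toMulEquiv.isDomain

lemma isPrime_nilradical_of_ker_le {R S : Type*} [CommRing R] [CommRing S] (f : R →+* S)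
    (hf : RingHom.ker f ≤ nilradical R) (hS : (nilradical S).IsPrime) :
    (nilradical R).IsPrime := by
  have : nilradical R = (nilradical S).comap f := by
    refine le_antisymm (fun x hx ↦ ?_) (fun x ⟨n, hn⟩ ↦ ?_)
    · exact (show IsNilpotent x from hx).map f
    · rw [← map_pow] at hn
      exact IsNilpotent.of_pow (show IsNilpotent (x ^ n) from hf hn)
  rw [this]
  exact Ideal.comap_isPrime f _

lemma isPrime_nilradical_of_forall_pow_mem_range {R S : Type*} [CommRing R] [CommRing S]
    (f : R →+* S) (hf : ∀ x : S, ∃ n > 0, x ^ n ∈ f.range) (hS : (nilradical R).IsPrime)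
    (hinj : RingHom.ker f ≤ nilradical R) :
    (nilradical S).IsPrime := by
  have key {r : R} (h : IsNilpotent (f r)) : IsNilpotent r := by
    obtain ⟨n, hn⟩ := h
    rw [← map_pow] at hn
    exact IsNilpotent.of_pow (show IsNilpotent (r ^ n) from hinj hn)
  refine ⟨fun h ↦ hS.ne_top ?_, fun {x y} hxy ↦ ?_⟩
  · rw [Ideal.eq_top_iff_one, mem_nilradical] at h ⊢
    exact key (by simpa using h)
  · simp only [mem_nilradical] at hxy ⊢
    obtain ⟨n, hn, a, ha⟩ := hf x
    obtain ⟨m, hm, b, hb⟩ := hf y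
    have hab : IsNilpotent (a * b) := by
      apply key
      rw [map_mul, ha, hb, ← Nat.sub_add_cancel hn, ← Nat.sub_add_cancel hm, pow_succ, pow_succ,
        mul_mul_mul_comm]
      exact (Commute.all _ _).isNilpotent_mul_left hxy
    rcases hS.mem_or_mem (show a * b ∈ nilradical R from hab) with h | h
    · left
      have := (show IsNilpotent a from h).map f
      rw [ha] at this
      exact IsNilpotent.of_pow this
    · right
      have := (show IsNilpotent b from h).map f
      rw [hb] at this
      exact IsNilpotent.of_pow this

lemma isPrime_nilradical_of_injective {R S : Type*} [CommRing R] [CommRing S] (f : R →+* S)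
    (hf : Function.Injective f) (hS : (nilradical S).IsPrime) : (nilradical R).IsPrime :=
  isPrime_nilradical_of_ker_le f ((RingHom.injective_iff_ker_eq_bot f).mp hf ▸ bot_le) hS

lemma isPrime_nilradical_of_isDomain (R : Type*) [CommRing R] [IsDomain R] :
    (nilradical R).IsPrime :=
  nilradical_eq_zero R ▸ Ideal.isPrime_bot

lemma isPrime_nilradical_tensorProduct_comm {F S T : Type*} [CommRing F] [CommRing S] [CommRing T]
    [Algebra F S] [Algebra F T] (h : (nilradical (T ⊗[F] S)).IsPrime) :
    (nilradical (S ⊗[F] T)).IsPrime :=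
  isPrime_nilradical_of_injective (Algebra.TensorProduct.comm F S T).toRingHom
    (Algebra.TensorProduct.comm F S T).injective h

lemma isPrime_nilradical_tensorProduct_of_isPurelyInseparable (k R : Type*) {S : Type*} [Field k]
    [Field R] [Algebra k R] [IsPurelyInseparable k R] [CommRing S] [Algebra k S]
    (hS : (nilradical S).IsPrime) : (nilradical (R ⊗[k] S)).IsPrime := by
  have hinj : Function.Injective (algebraMap S (S ⊗[k] R)) :=
    Algebra.TensorProduct.includeLeft_injective (S := S) (algebraMap k R).injective
  have : (nilradical (S ⊗[k] R)).IsPrime :=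
    isPrime_nilradical_of_forall_pow_mem_range (algebraMap S (S ⊗[k] R))
      IsPurelyInseparable.exists_pow_mem_range_tensorProduct hS
      ((RingHom.injective_iff_ker_eq_bot _).mp hinj ▸ bot_le)
  exact isPrime_nilradical_tensorProduct_comm this

lemma isPrime_nilradical_tensorProduct_of_isAlgClosed (Ω E : Type*) {D : Type*} [Field Ω]
    [IsAlgClosed Ω] [CommRing E] [IsDomain E] [Algebra Ω E] [CommRing D] [Algebra Ω D]
    (hD : (nilradical D).IsPrime) : (nilradical (E ⊗[Ω] D)).IsPrime := by
  have := isDomain_tensorProduct_of_isAlgClosed Ω E (D ⧸ nilradical D)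
  refine isPrime_nilradical_of_ker_le (Algebra.TensorProduct.map (AlgHom.id Ω E)
    (Ideal.Quotient.mkₐ Ω (nilradical D))).toRingHom ?_ ?_
  · have h := Algebra.TensorProduct.lTensor_ker (A := E) (Ideal.Quotient.mkₐ Ω (nilradical D))
      (Ideal.Quotient.mkₐ_surjective _ _)
    refine h.le.trans ?_
    rw [Ideal.map_le_iff_le_comap]
    intro x hx
    replace hx : x ∈ nilradical D := Ideal.Quotient.eq_zero_iff_mem.mp hx
    exact (show IsNilpotent x from hx).map _
  · exact isPrime_nilradical_of_isDomain (E ⊗[Ω] (D ⧸ nilradical D))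

lemma isPrime_nilradical_tensorProduct_of_tower (F S T K : Type*) [CommRing F] [CommRing S]
    [CommRing T] [CommRing K] [Algebra F S] [Algebra S T] [Algebra F T] [IsScalarTower F S T]
    [Algebra F K] (h : (nilradical (T ⊗[S] (S ⊗[F] K))).IsPrime) :
    (nilradical (T ⊗[F] K)).IsPrime :=
  isPrime_nilradical_of_injective
    (Algebra.TensorProduct.cancelBaseChange F S S T K).symm.toRingEquiv.toRingHom
    (Algebra.TensorProduct.cancelBaseChange F S S T K).symm.injective h

/-- An extension `K / F` in which `F` is separably closed is geometrically irreducible. -/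
lemma isPrime_nilradical_tensorProduct_of_separableClosure_eq_bot (F K E : Type*) [Field F]
    [Field K] [Field E] [Algebra F K] [Algebra F E] (h : separableClosure F K = ⊥) :
    (nilradical (K ⊗[F] E)).IsPrime := by
  let Ω := AlgebraicClosure E
  let f : AlgebraicClosure F →ₐ[F] Ω := IsAlgClosed.lift
  algebraize [f.toRingHom]
  have : IsScalarTower F (AlgebraicClosure F) Ω := .of_algHom f
  have hs : (nilradical (SeparableClosure F ⊗[F] K)).IsPrime := by
    have := isDomain_tensorProduct_of_isSeparable F K (SeparableClosure F) h
    exact isPrime_nilradical_tensorProduct_comm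
      (isPrime_nilradical_of_isDomain (K ⊗[F] SeparableClosure F))
  have ha : (nilradical (AlgebraicClosure F ⊗[F] K)).IsPrime :=
    isPrime_nilradical_tensorProduct_of_tower F (SeparableClosure F) _ K <|
      isPrime_nilradical_tensorProduct_of_isPurelyInseparable (SeparableClosure F) _ hs
  have hΩ : (nilradical (Ω ⊗[F] K)).IsPrime :=
    isPrime_nilradical_tensorProduct_of_tower F (AlgebraicClosure F) Ω K <|
      isPrime_nilradical_tensorProduct_of_isAlgClosed (AlgebraicClosure F) Ω ha
  refine isPrime_nilradical_tensorProduct_comm <| isPrime_nilradical_of_injective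
    (Algebra.TensorProduct.map (IsScalarTower.toAlgHom F E Ω) (AlgHom.id F K)).toRingHom ?_ hΩ
  exact Module.Flat.rTensor_preserves_injective_linearMap
    (IsScalarTower.toAlgHom F E Ω).toLinearMap (algebraMap E Ω).injective

/-- If `F` is separably closed in `K`, the fibres of `Spec (K ⊗[F] R) → Spec R` are irreducible. -/
lemma exists_isPrime_forall_le_of_comap_eq (F K R : Type*) [Field F] [Field K] [CommRing R]
    [Algebra F K] [Algebra F R] (h : separableClosure F K = ⊥) (p : Ideal R) [p.IsPrime] :
    ∃ N : Ideal (K ⊗[F] R), N.IsPrime ∧ ∀ P : Ideal (K ⊗[F] R), P.IsPrime →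
      P.comap (Algebra.TensorProduct.includeRight : R →ₐ[F] K ⊗[F] R) = p → N ≤ P := by
  let φ : K ⊗[F] R →ₐ[F] K ⊗[F] p.ResidueField :=
    Algebra.TensorProduct.map (AlgHom.id F K) (IsScalarTower.toAlgHom F R p.ResidueField)
  have hN := isPrime_nilradical_tensorProduct_of_separableClosure_eq_bot F K p.ResidueField h
  refine ⟨(nilradical (K ⊗[F] p.ResidueField)).comap φ, Ideal.comap_isPrime φ _,
    fun P hP hPp x hx ↦ ?_⟩
  let g : p.ResidueField →ₐ[F] P.ResidueField :=
    Ideal.ResidueField.mapₐ p P Algebra.TensorProduct.includeRight hPp.symm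
  let c : K →ₐ[F] P.ResidueField :=
    (IsScalarTower.toAlgHom F (K ⊗[F] R) P.ResidueField).comp Algebra.TensorProduct.includeLeft
  let θ : K ⊗[F] p.ResidueField →ₐ[F] P.ResidueField :=
    Algebra.TensorProduct.lift c g (fun _ _ ↦ .all _ _)
  have hθ : θ.comp φ = IsScalarTower.toAlgHom F (K ⊗[F] R) P.ResidueField := by
    ext a
    · simp [θ, φ, c]
    · have hg : g (algebraMap R p.ResidueField a) =
          algebraMap (K ⊗[F] R) P.ResidueField (1 ⊗ₜ[F] a) :=
        Ideal.ResidueField.map_algebraMap p P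
          (Algebra.TensorProduct.includeRight : R →ₐ[F] K ⊗[F] R).toRingHom hPp.symm a
      simpa [θ, φ] using hg
  have hx' : IsNilpotent (φ x) := hx
  have h0 := (hx'.map θ).eq_zero
  rw [← AlgHom.comp_apply, hθ] at h0
  exact Ideal.algebraMap_residueField_eq_zero.mp h0

/-- If `F` is separably closed in `K`, a minimal prime of `K ⊗[k] R` is determined by its
contraction to `F ⊗[k] R`. -/
lemma eq_of_comap_tensorProduct_map_eq {k F K R : Type*} [Field k] [Field F] [Field K]
    [Algebra k F] [Algebra F K] [Algebra k K] [IsScalarTower k F K] [CommRing R] [Algebra k R]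
    (hF : separableClosure F K = ⊥) {P Q : Ideal (K ⊗[k] R)}
    (hP : P ∈ minimalPrimes (K ⊗[k] R)) (hQ : Q ∈ minimalPrimes (K ⊗[k] R))
    (h : P.comap (Algebra.TensorProduct.map (IsScalarTower.toAlgHom k F K) (AlgHom.id k R)) =
      Q.comap (Algebra.TensorProduct.map (IsScalarTower.toAlgHom k F K) (AlgHom.id k R))) :
    P = Q := by
  have hPp : P.IsPrime := hP.1.1
  have hQp : Q.IsPrime := hQ.1.1
  let ι : F ⊗[k] R →ₐ[k] K ⊗[k] R :=
    Algebra.TensorProduct.map (IsScalarTower.toAlgHom k F K) (AlgHom.id k R)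
  let e : K ⊗[F] (F ⊗[k] R) ≃ₐ[F] K ⊗[k] R := Algebra.TensorProduct.cancelBaseChange k F F K R
  have he (x) : e (Algebra.TensorProduct.includeRight x) = ι x := by
    induction x with
    | zero => simp
    | add x y hx hy => simp only [map_add, hx, hy]
    | tmul a r => simp [e, ι, Algebra.smul_def]
  obtain ⟨N, hN, hle⟩ := exists_isPrime_forall_le_of_comap_eq F K (F ⊗[k] R)
    hF (P.comap ι)
  have key (T : Ideal (K ⊗[k] R)) (hT : T.IsPrime) (hTp : T.comap ι = P.comap ι) :
      N.comap e.symm ≤ T := by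
    intro x hx
    have := hle (T.comap e) (Ideal.comap_isPrime e T) (by
      rw [← hTp]
      ext x
      simp only [Ideal.mem_comap, he]) hx
    simpa using this
  have hN' : (N.comap e.symm).IsPrime := Ideal.comap_isPrime e.symm N
  have hPN : P ≤ N.comap e.symm := hP.2 ⟨hN', bot_le⟩ (key P hPp rfl)
  have hQN : Q ≤ N.comap e.symm := hQ.2 ⟨hN', bot_le⟩ (key Q hQp h.symm)
  exact le_antisymm (hPN.trans (key Q hQp h.symm)) (hQN.trans (key P hPp rfl))

lemma isMaximal_of_isPrime_tensorProduct (k S L : Type*) [Field k] [Field S] [Field L]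
    [Algebra k S] [Algebra k L] [Algebra.IsIntegral k S] (p : Ideal (L ⊗[k] S)) [p.IsPrime] :
    p.IsMaximal :=
  Ideal.isMaximal_of_isIntegral_of_isMaximal_comap (R := L) p
    ((Ideal.bot_isMaximal (K := L)).eq_of_le (Ideal.comap_isPrime (algebraMap L (L ⊗[k] S)) p).ne_top bot_le ▸
      Ideal.bot_isMaximal)

/-- Distinct minimal primes of `K ⊗[k] L` have distinct contractions to the tensor product of the
separable algebraic closures of `k`. -/
lemma eq_of_comap_separableClosure_eq {k K L : Type*} [Field k] [Field K] [Field L] [Algebra k K]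
    [Algebra k L] {P Q : Ideal (K ⊗[k] L)} (hP : P ∈ minimalPrimes (K ⊗[k] L))
    (hQ : Q ∈ minimalPrimes (K ⊗[k] L))
    (h : P.comap (Algebra.TensorProduct.map (separableClosure k K).val
        (separableClosure k L).val) =
      Q.comap (Algebra.TensorProduct.map (separableClosure k K).val (separableClosure k L).val)) :
    P = Q := by
  have hPp : P.IsPrime := hP.1.1
  have hQp : Q.IsPrime := hQ.1.1
  refine eq_of_comap_tensorProduct_map_eq (F := separableClosure k K)
    (separableClosure.separableClosure_eq_bot k K) hP hQ ?_
  let f : L ⊗[k] separableClosure k K →ₐ[k] K ⊗[k] L :=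
    (Algebra.TensorProduct.map (IsScalarTower.toAlgHom k (separableClosure k K) K)
      (AlgHom.id k L)).comp (Algebra.TensorProduct.comm k L (separableClosure k K)).toAlgHom
  have hmin (T : Ideal (K ⊗[k] L)) (hT : T.IsPrime) :
      T.comap f ∈ minimalPrimes (L ⊗[k] separableClosure k K) := by
    have hTf : (T.comap f).IsPrime := Ideal.comap_isPrime f T
    refine ⟨⟨hTf, bot_le⟩, fun J hJ hJT ↦ ?_⟩
    have := hJ.1
    have := isMaximal_of_isPrime_tensorProduct k (separableClosure k K) L J
    exact (this.eq_of_le hTf.ne_top hJT).ge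
  have key : P.comap f = Q.comap f := by
    refine eq_of_comap_tensorProduct_map_eq (F := separableClosure k L)
      (separableClosure.separableClosure_eq_bot k L) (hmin P hPp) (hmin Q hQp) ?_
    have hcomp : f.comp (Algebra.TensorProduct.map
          (IsScalarTower.toAlgHom k (separableClosure k L) L) (AlgHom.id k _)) =
        (Algebra.TensorProduct.map (separableClosure k K).val (separableClosure k L).val).comp
          (Algebra.TensorProduct.comm k _ _).toAlgHom := by
      ext <;> simp [f]
    ext x
    have h1 := Ideal.ext_iff.mp h (Algebra.TensorProduct.comm k _ _ x)
    have h2 := DFunLike.congr_fun hcomp x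
    simp only [AlgHom.comp_apply] at h2
    simp only [Ideal.mem_comap] at h1 ⊢
    rw [h2]
    exact h1
  ext x
  have h1 := Ideal.ext_iff.mp key ((Algebra.TensorProduct.comm k _ _).symm x)
  simpa [f, Ideal.mem_comap] using h1

/-- The separable algebraic closure of `k` in the fraction field of an integrally closed domain `A`
is contained in `A`. -/
lemma exists_separableClosure_algHom (k A : Type*) [Field k] [CommRing A] [IsDomain A]
    [Algebra k A] [IsIntegrallyClosed A] :
    ∃ f : separableClosure k (FractionRing A) →ₐ[k] A,
      (IsScalarTower.toAlgHom k A (FractionRing A)).comp f =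
        (separableClosure k (FractionRing A)).val := by
  let i := IsScalarTower.toAlgHom k A (FractionRing A)
  have hi : Function.Injective i := IsFractionRing.injective A (FractionRing A)
  have hmem (x : separableClosure k (FractionRing A)) : (x : FractionRing A) ∈ i.range :=
    IsIntegrallyClosed.isIntegral_iff.mp
      ((mem_separableClosure_iff.mp x.2).isIntegral.tower_top (A := A))
  refine ⟨(AlgEquiv.ofInjective i hi).symm.toAlgHom.comp
    ((separableClosure k (FractionRing A)).val.codRestrict i.range hmem), ?_⟩
  ext x
  exact congrArg Subtype.val ((AlgEquiv.ofInjective i hi).apply_symm_apply ⟨x, hmem x⟩)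

/-- The tensor product of two integrally closed domains over a
field satisfies MPC. -/
theorem stmt9 {k A B : Type*} [Field k] [CommRing A] [CommRing B] [IsDomain A]
    [IsDomain B] [Algebra k A] [Algebra k B] [IsIntegrallyClosed A]
    [IsIntegrallyClosed B] : MPC (A ⊗[k] B) := by
  intro p hp q hq hpq
  let K := FractionRing A
  let L := FractionRing B
  let iA := IsScalarTower.toAlgHom k A K
  let iB := IsScalarTower.toAlgHom k B L
  have hiA : Function.Injective iA := IsFractionRing.injective A K
  have hiB : Function.Injective iB := IsFractionRing.injective B L
  let j : A ⊗[k] B →ₐ[k] K ⊗[k] L := Algebra.TensorProduct.map iA iB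
  have hj : Function.Injective j :=
    TensorProduct.map_injective_of_flat_flat iA.toLinearMap iB.toLinearMap hiA hiB
  obtain ⟨sA, hsA⟩ := exists_separableClosure_algHom k A
  obtain ⟨sB, hsB⟩ := exists_separableClosure_algHom k B
  have hjs : j.comp (Algebra.TensorProduct.map sA sB) =
      Algebra.TensorProduct.map (separableClosure k K).val (separableClosure k L).val := by
    rw [← Algebra.TensorProduct.map_comp, hsA, hsB]
  have hlift (p) (hp : p ∈ minimalPrimes (A ⊗[k] B)) :
      ∃ P ∈ minimalPrimes (K ⊗[k] L), P.comap j.toRingHom = p :=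
    Ideal.exists_minimalPrimes_comap_eq j.toRingHom p
      ((Ideal.comap_bot_of_injective j.toRingHom hj).symm ▸ hp)
  obtain ⟨P, hP, rfl⟩ := hlift p hp
  obtain ⟨Q, hQ, rfl⟩ := hlift q hq
  let s := Algebra.TensorProduct.map (separableClosure k K).val (separableClosure k L).val
  have hne : P.comap s ≠ Q.comap s := fun h ↦ hpq (eq_of_comap_separableClosure_eq hP hQ h ▸ rfl)
  have := hP.1.1
  have := hQ.1.1
  have hPm := isMaximal_of_isPrime_tensorProduct k _ _ (P.comap s)
  have hQm := isMaximal_of_isPrime_tensorProduct k _ _ (Q.comap s)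
  have htop := hPm.coprime_of_ne hQm hne
  rw [Ideal.eq_top_iff_one, Submodule.mem_sup] at htop ⊢
  obtain ⟨a, ha, b, hb, hab⟩ := htop
  refine ⟨Algebra.TensorProduct.map sA sB a, ?_, Algebra.TensorProduct.map sA sB b, ?_, ?_⟩
  · change j.comp (Algebra.TensorProduct.map sA sB) a ∈ P
    rw [hjs]; exact ha
  · change j.comp (Algebra.TensorProduct.map sA sB) b ∈ Q
    rw [hjs]; exact hb
  · rw [← map_add, hab, map_one]
end

section
/- If A is a commutative ring satisfying MPC, then the polynomial ring A[X₁,...,Xₙ] is an S-ring for every integer n ≥ 1. -/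
open Polynomial TensorProduct

namespace Ideal

theorem height_eq_one_iff_of_isDomain {D : Type*} [CommRing D] [IsDomain D] (p : Ideal D)
    [p.IsPrime] : p.height = 1 ↔ p ≠ ⊥ ∧ ∀ q : Ideal D, q.IsPrime → q < p → q = ⊥ := by
  have height_zero (q : Ideal D) [q.IsPrime] : q.height = 0 ↔ q = ⊥ := by
    rw [height_eq_zero_iff, IsDomain.minimalPrimes_eq_singleton_bot, Set.mem_singleton_iff]
  have height_le : p.height ≤ 1 ↔ ∀ q : Ideal D, q.IsPrime → q < p → q = ⊥ := by
    rw [← Nat.cast_one, height_le_iff]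
    refine forall₃_congr fun q hq _ ↦ ?_
    rw [Nat.cast_one, Order.lt_one_iff, height_zero]
  rw [← height_le, ne_eq, ← height_zero, ← ne_eq, ← Order.one_le_iff_ne_zero, and_comm]
  exact le_antisymm_iff

theorem isPrime_map_mvPolynomial_C {R σ : Type*} [CommRing R] (p : Ideal R) [p.IsPrime] :
    (p.map (MvPolynomial.C (σ := σ))).IsPrime := by
  rw [← Quotient.isDomain_iff_prime]
  exact (MvPolynomial.quotientEquivQuotientMvPolynomial (σ := σ) p).symm.toMulEquiv.isDomain _

theorem comap_map_mvPolynomial_C {R σ : Type*} [CommRing R] (p : Ideal R) :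
    (p.map (MvPolynomial.C (σ := σ))).comap MvPolynomial.C = p := by
  refine le_antisymm (fun x hx ↦ ?_) le_comap_map
  classical
  simpa using MvPolynomial.mem_map_C_iff.mp hx 0

theorem comap_map_polynomial_C {R : Type*} [CommRing R] (p : Ideal R) :
    (p.map (C : R →+* R[X])).comap C = p := by
  refine le_antisymm (fun x hx ↦ ?_) le_comap_map
  simpa using mem_map_C_iff.mp hx 0

theorem mem_map_C_map_C_iff {R : Type*} [CommRing R] {p : Ideal R} {f : R[X][X]} :
    f ∈ (p.map (C : R →+* R[X])).map (C : R[X] →+* R[X][X]) ↔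
      ∀ i j, (f.coeff i).coeff j ∈ p := by
  simp only [mem_map_C_iff]

theorem comap_map_C_mem_minimalPrimes {R σ : Type*} [CommRing R]
    {P : Ideal (MvPolynomial σ R)} (hP : P ∈ minimalPrimes (MvPolynomial σ R)) :
    P.comap MvPolynomial.C ∈ minimalPrimes R ∧ P = (P.comap MvPolynomial.C).map MvPolynomial.C := by
  have := hP.1.1
  have eq_map (q : Ideal R) [q.IsPrime] (hq : q ≤ P.comap MvPolynomial.C) :
      P = q.map MvPolynomial.C :=
    have hqP := map_le_iff_le_comap.mpr hq
    le_antisymm (hP.2 ⟨isPrime_map_mvPolynomial_C q, bot_le⟩ hqP) hqP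
  refine ⟨⟨⟨inferInstance, bot_le⟩, fun q ⟨hq, _⟩ hle ↦ ?_⟩, eq_map _ le_rfl⟩
  rw [eq_map q hle, comap_map_mvPolynomial_C]

end Ideal

theorem MPC.mvPolynomial {A σ : Type*} [CommRing A] (hA : MPC A) : MPC (MvPolynomial σ A) := by
  intro P hP Q hQ hne
  obtain ⟨hp, hP⟩ := Ideal.comap_map_C_mem_minimalPrimes hP
  obtain ⟨hq, hQ⟩ := Ideal.comap_map_C_mem_minimalPrimes hQ
  rw [hP, hQ, ← Ideal.map_sup, hA _ hp _ hq fun h ↦ hne (by rw [hP, hQ, h]), Ideal.map_top]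

theorem isSDomain_iff_s11 {D : Type*} [CommRing D] [IsDomain D] : IsSDomain D ↔
    ∀ p : Ideal D, p.IsPrime → p.height = 1 → (p.map (C : D →+* D[X])).height = 1 := by
  constructor
  · intro h p hp hp1
    have := Ideal.isPrime_map_C_of_isPrime (P := p)
    have := h ⟨p, hp⟩ (by rwa [← PrimeSpectrum.height_eq_orderHeight]) ⟨_, this⟩ rfl
    rwa [← PrimeSpectrum.height_eq_orderHeight] at this
  · intro h p hp P hP
    rw [← PrimeSpectrum.height_eq_orderHeight] at hp ⊢
    rw [hP]
    exact h _ p.2 hp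

theorem IsSDomain.of_ringEquiv {D E : Type*} [CommRing D] [IsDomain D] [CommRing E] [IsDomain E]
    (e : D ≃+* E) (hD : IsSDomain D) : IsSDomain E := by
  rw [isSDomain_iff_s11] at hD ⊢
  intro p hp hp1
  have h := hD (p.comap e) inferInstance (by rw [e.height_comap, hp1])
  rw [← h, ← (Polynomial.mapEquiv e).height_map]
  conv_lhs => rw [← Ideal.map_comap_of_surjective e e.surjective p]
  change (((p.comap e).map (e : D →+* E)).map C).height =
    (((p.comap e).map C).map (Polynomial.mapEquiv e : D[X] →+* E[X])).height
  rw [Ideal.map_map, Ideal.map_map]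
  congr 2
  ext; simp

theorem Ideal.height_map_C_of_comap_eq_bot {D : Type*} [CommRing D] [IsDomain D] (P : Ideal D[X])
    [P.IsPrime] (hP : P.comap C = ⊥) (hP0 : P ≠ ⊥) :
    (P.map (C : D[X] →+* D[X][X])).height = P.height := by
  let := Polynomial.algebra D (FractionRing D)
  let := Polynomial.algebra D[X] (FractionRing D)[X]
  let M : Submonoid D[X] := (nonZeroDivisors D).map C
  have : IsLocalization M (FractionRing D)[X] := Polynomial.isLocalization _ _
  have : IsLocalization (M.map C) (FractionRing D)[X][X] := Polynomial.isLocalization _ _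
  have hPM : Disjoint (M : Set D[X]) P := by
    refine Set.disjoint_left.mpr fun _ ⟨a, ha, h⟩ hb ↦ nonZeroDivisors.ne_zero ha ?_
    rw [← Ideal.mem_bot, ← hP, Ideal.mem_comap]
    exact h ▸ hb
  have hPM' : Disjoint (M.map C : Set D[X][X]) (P.map (C : D[X] →+* D[X][X])) := by
    refine Set.disjoint_left.mpr fun _ ⟨a, ha, h⟩ hb ↦ Set.disjoint_left.mp hPM ha ?_
    rw [← comap_map_polynomial_C P]
    exact (congrArg (· ∈ P.map C) h).mpr hb
  have := Ideal.isPrime_map_C_of_isPrime (P := P)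
  let P' := P.map (algebraMap D[X] (FractionRing D)[X])
  have : P'.IsPrime := IsLocalization.isPrime_of_isPrime_disjoint M _ P ‹_› hPM
  have hP' : P' ≠ ⊥ := by
    intro h
    apply hP0
    rw [← IsLocalization.under_map_of_isPrime_disjoint M (FractionRing D)[X] ‹P.IsPrime› hPM]
    change Ideal.comap _ P' = ⊥
    rw [h, ← RingHom.ker_eq_comap_bot, ← RingHom.injective_iff_ker_eq_bot]
    exact Polynomial.map_injective _ (IsFractionRing.injective D _)
  have : P'.IsMaximal := IsPrime.to_maximal_ideal hP'
  rw [← IsLocalization.height_map_of_disjoint M (S := (FractionRing D)[X]) P hPM,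
    ← IsLocalization.height_map_of_disjoint (M.map C) (S := (FractionRing D)[X][X]) _ hPM',
    ← Polynomial.height_map_C P', Ideal.map_map, Ideal.map_map]
  congr 2
  ext <;> simp [Polynomial.algebraMap_def]

theorem exists_notMem_integral_mul_or {E K : Type*} [CommRing E] [Field K] [Algebra E K]
    [IsIntegrallyClosedIn E K] (P : Ideal E) (u : K) (g : E[X]) (hg : aeval u g = 0)
    (hgP : g ∉ P.map (C : E →+* E[X])) :
    ∃ s ∉ P, ∃ t, algebraMap E K s * u = algebraMap E K t ∨
      algebraMap E K s = algebraMap E K t * u := by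
  induction hn : g.natDegree using Nat.strong_induction_on generalizing g with | _ n ih =>
  subst hn
  obtain ⟨w, hw⟩ := IsIntegrallyClosedIn.isIntegral_iff.mp (isIntegral_leadingCoeff_smul g u hg)
  rw [Algebra.smul_def] at hw
  by_cases hs : g.leadingCoeff ∈ P
  swap
  · exact ⟨_, hs, w, .inl hw.symm⟩
  by_cases hwP : w ∈ P
  swap
  · exact ⟨w, hwP, _, .inr hw⟩
  have hdeg : g.natDegree ≠ 0 := by
    intro h
    rw [eq_C_of_natDegree_eq_zero h] at hs hgP
    exact hgP (Ideal.mem_map_of_mem _ (by simpa using hs))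
  obtain ⟨m, hm⟩ := Nat.exists_eq_succ_of_ne_zero hdeg
  refine ih (g.eraseLead + monomial m w).natDegree ?_ (g.eraseLead + monomial m w) ?_ ?_ rfl
  · refine (natDegree_add_le_of_degree_le (n := m) ?_ (natDegree_monomial_le _)).trans_lt (by lia)
    exact g.eraseLead_natDegree_le.trans (by lia)
  · rw [← hg]
    conv_rhs => rw [← g.eraseLead_add_monomial_natDegree_leadingCoeff]
    simp only [map_add, aeval_monomial, hw, hm, pow_succ]
    ring
  · intro h
    apply hgP
    rw [← g.eraseLead_add_monomial_natDegree_leadingCoeff]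
    have hmon (k : ℕ) {a : E} (ha : a ∈ P) : monomial k a ∈ P.map (C : E →+* E[X]) := by
      rw [← C_mul_X_pow_eq_monomial]
      exact Ideal.mul_mem_right _ _ (Ideal.mem_map_of_mem _ ha)
    exact add_mem ((Ideal.add_mem_iff_left _ (hmon _ hwP)).mp h) (hmon _ hs)

theorem exists_dvd_mul_of_total {E : Type*} [CommRing E] (P : Ideal E) [P.IsPrime]
    (hE : ∀ a b : E, ∃ s ∉ P, a ∣ s * b ∨ b ∣ s * a) (T : Finset E) (hT : T.Nonempty) :
    ∃ c ∈ T, ∃ s ∉ P, ∀ a ∈ T, c ∣ s * a := by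
  induction hT using Finset.Nonempty.cons_induction with
  | singleton a => exact ⟨a, by simp, 1, P.one_notMem, by simp⟩
  | cons b T hb hT ih =>
    obtain ⟨c, hc, s, hs, h⟩ := ih
    obtain ⟨r, hr, hcb | hbc⟩ := hE c b
    · refine ⟨c, by simp [hc], r * s, ‹P.IsPrime›.mul_notMem hr hs, ?_⟩
      simp only [Finset.mem_cons, forall_eq_or_imp]
      refine ⟨(hcb.mul_left s).trans (by ring_nf; rfl), fun a ha ↦ ?_⟩
      rw [mul_assoc]
      exact (h a ha).mul_left r
    · refine ⟨b, by simp, r * s, ‹P.IsPrime›.mul_notMem hr hs, ?_⟩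
      simp only [Finset.mem_cons, forall_eq_or_imp]
      refine ⟨Dvd.intro_left _ rfl, fun a ha ↦ hbc.trans ?_⟩
      rw [mul_assoc]
      exact mul_dvd_mul_left r (h a ha)

theorem exists_C_mul_eq_C_mul {E : Type*} [CommRing E] [IsDomain E] (P : Ideal E) [P.IsPrime]
    (hE : ∀ a b : E, ∃ s ∉ P, a ∣ s * b ∨ b ∣ s * a) (f : E[X][X]) (hf : f ≠ 0) :
    ∃ c s : E, c ≠ 0 ∧ ∃ f₁ : E[X][X], C (C s) * f = C (C c) * f₁ ∧
      f₁ ∉ (P.map (C : E →+* E[X])).map (C : E[X] →+* E[X][X]) := by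
  classical
  let T : Finset E := f.support.biUnion fun i ↦ (f.coeff i).support.image (f.coeff i).coeff
  have hT (i j : ℕ) (h : (f.coeff i).coeff j ≠ 0) : (f.coeff i).coeff j ∈ T := by
    simp only [T, Finset.mem_biUnion, Finset.mem_image, mem_support_iff]
    exact ⟨i, fun h0 ↦ h (by simp [h0]), j, h, rfl⟩
  have hT0 : T.Nonempty :=
    ⟨_, hT f.natDegree f.leadingCoeff.natDegree (by simpa using hf)⟩
  obtain ⟨c, hc, s, hs, h⟩ := exists_dvd_mul_of_total P hE T hT0
  simp only [T, Finset.mem_biUnion, Finset.mem_image, mem_support_iff] at hc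
  obtain ⟨i, -, j, hc0, hc⟩ := hc
  obtain ⟨f₁, hf₁⟩ : C (C c) ∣ C (C s) * f := by
    simp only [C_dvd_iff_dvd_coeff, coeff_C_mul]
    intro k l
    by_cases hkl : (f.coeff k).coeff l = 0
    · simp [hkl]
    · exact h _ (hT k l hkl)
  refine ⟨c, s, hc ▸ hc0, f₁, hf₁, fun hmem ↦ hs ?_⟩
  have := congrArg (fun g ↦ (g.coeff i).coeff j) hf₁
  simp only [coeff_C_mul, hc] at this
  rw [mul_comm] at this
  rw [mul_left_cancel₀ (hc ▸ hc0) this]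
  exact Ideal.mem_map_C_map_C_iff.mp hmem i j

theorem exists_notMem_dvd_mul_or {E K : Type*} [CommRing E] [Field K] [Algebra E K]
    [FaithfulSMul E K] [IsIntegrallyClosedIn E K] (P : Ideal E) [P.IsPrime]
    (h : ∀ u : K, ∃ g : E[X], aeval u g = 0 ∧ g ∉ P.map (C : E →+* E[X])) (a b : E) :
    ∃ s ∉ P, a ∣ s * b ∨ b ∣ s * a := by
  have hinj := FaithfulSMul.algebraMap_injective E K
  by_cases hb : b = 0
  · exact ⟨1, P.one_notMem, .inl (by simp [hb])⟩
  have hb' : algebraMap E K b ≠ 0 := by simpa using hb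
  obtain ⟨g, hg, hgP⟩ := h (algebraMap E K a / algebraMap E K b)
  obtain ⟨s, hs, t, h | h⟩ := exists_notMem_integral_mul_or P _ g hg hgP
  · refine ⟨s, hs, .inr ⟨t, hinj ?_⟩⟩
    field_simp at h
    simpa [mul_comm] using h
  · refine ⟨s, hs, .inl ⟨t, hinj ?_⟩⟩
    field_simp at h
    simpa [mul_comm] using h

theorem Ideal.exists_aeval_eq_zero_notMem_map_C {D K : Type*} [CommRing D] [IsDomain D] [Field K]
    [Algebra D K] [IsFractionRing D K] (p : Ideal D) [p.IsPrime]
    (hp : (p.map (C : D →+* D[X])).height = 1) (u : K) :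
    ∃ g : D[X], aeval u g = 0 ∧ g ∉ p.map (C : D →+* D[X]) := by
  by_contra! h
  have := isPrime_map_C_of_isPrime (P := p)
  have hker : (RingHom.ker (aeval (R := D) u)).IsPrime := RingHom.ker_isPrime _
  rw [height_eq_one_iff_of_isDomain] at hp
  have hinj := IsFractionRing.injective D K
  obtain ⟨a, b, hb, rfl⟩ := IsFractionRing.div_surjective D u
  have hb0 : b ≠ 0 := nonZeroDivisors.ne_zero hb
  have hmem : C b * X - C a ∈
      RingHom.ker (aeval (R := D) (algebraMap D K a / algebraMap D K b)) := by
    have : algebraMap D K b ≠ 0 := by simpa using hb0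
    simp [RingHom.mem_ker, mul_div_cancel₀ _ this]
  have hne : C b * X - C a ≠ 0 := fun h0 ↦ hb0 (by simpa using congrArg (coeff · 1) h0)
  rcases eq_or_lt_of_le (show RingHom.ker (aeval (R := D) _) ≤ p.map C from h) with heq | hlt
  · apply hp.1
    rw [Ideal.map_eq_bot_iff_of_injective C_injective, eq_bot_iff]
    intro x hx
    have := heq.ge (mem_map_of_mem C hx)
    simpa [RingHom.mem_ker] using this
  · exact hne (by simpa [hp.2 _ hker hlt] using hmem)

theorem Ideal.height_map_C_map_C_eq_one_of_isIntegral {D : Type*} (E K : Type*) [CommRing D]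
    [IsDomain D] [CommRing E] [IsDomain E] [Field K] [Algebra D E] [Algebra D K] [Algebra E K]
    [IsScalarTower D E K] [Algebra.IsIntegral D E] [IsFractionRing D K] [FaithfulSMul D E]
    [FaithfulSMul E K] [IsIntegrallyClosedIn E K] (p : Ideal D) [p.IsPrime]
    (hp : (p.map (C : D →+* D[X])).height = 1) :
    ((p.map (C : D →+* D[X])).map (C : D[X] →+* D[X][X])).height = 1 := by
  let := Polynomial.algebra D E
  let := Polynomial.algebra D[X] E[X]
  have hinj : Function.Injective (algebraMap D[X][X] E[X][X]) :=
    Polynomial.map_injective _ (Polynomial.map_injective _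
      (FaithfulSMul.algebraMap_injective D E))
  have hpX := isPrime_map_C_of_isPrime (P := p)
  have hpXY := isPrime_map_C_of_isPrime (P := p.map C)
  have hp' := hp
  rw [height_eq_one_iff_of_isDomain] at hp ⊢
  refine ⟨by rw [ne_eq, Ideal.map_eq_bot_iff_of_injective C_injective]; exact hp.1,
    fun Q hQ hlt ↦ ?_⟩
  have hQX : Q.comap C = ⊥ := by
    refine hp.2 _ inferInstance (lt_of_le_of_ne ?_ fun h ↦ hlt.not_ge ?_)
    · rw [← comap_map_polynomial_C (p.map C)]
      exact comap_mono hlt.le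
    · exact map_le_iff_le_comap.mpr h.ge
  obtain ⟨Q', -, hQ', hQQ'⟩ := exists_ideal_over_prime_of_isIntegral (S := E[X][X]) Q ⊥ (by
    rw [← RingHom.ker_eq_comap_bot, (RingHom.injective_iff_ker_eq_bot _).mp hinj]
    exact bot_le)
  obtain ⟨P', hQP', hP', hPP'⟩ := exists_ideal_over_prime_of_isIntegral
    ((p.map (C : D →+* D[X])).map (C : D[X] →+* D[X][X])) Q' (hQQ'.trans_le hlt.le)
  let P : Ideal E := (P'.comap C).comap C
  have hP : P.comap (algebraMap D E) = p := by
    rw [← comap_map_polynomial_C p, ← comap_map_polynomial_C (p.map C), ← hPP']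
    simp only [P, comap_comap]
    congr 1
    ext; simp [algebraMap_def]
  have hPX := isPrime_map_C_of_isPrime (P := P)
  have hPXY := isPrime_map_C_of_isPrime (P := P.map C)
  have hP'_eq : (P.map (C : E →+* E[X])).map (C : E[X] →+* E[X][X]) = P' := by
    have hle : (P.map (C : E →+* E[X])).map (C : E[X] →+* E[X][X]) ≤ P' :=
      map_le_iff_le_comap.mpr (map_le_iff_le_comap.mpr le_rfl)
    refine hle.eq_of_not_lt fun h ↦
      ((IsIntegral.comap_lt_comap (R := D[X][X]) h).trans_eq hPP').not_ge fun f hf ↦ ?_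
    rw [mem_map_C_map_C_iff] at hf
    rw [mem_comap, mem_map_C_map_C_iff]
    intro i j
    rw [← hP] at hf
    simpa [algebraMap_def] using hf i j
  have hE (a b : E) : ∃ s ∉ P, a ∣ s * b ∨ b ∣ s * a := by
    refine exists_notMem_dvd_mul_or (K := K) P (fun u ↦ ?_) a b
    obtain ⟨g, hg, hgp⟩ := p.exists_aeval_eq_zero_notMem_map_C hp' u
    refine ⟨g.map (algebraMap D E), by simpa using hg, fun hmem ↦ hgp ?_⟩
    rw [mem_map_C_iff] at hmem ⊢
    intro n
    rw [← hP]
    simpa using hmem n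
  have hQ'0 : Q' = ⊥ := by
    rw [eq_bot_iff]
    intro f hf
    by_contra hf0
    obtain ⟨c, s, hc, f₁, hf₁, hf₁P⟩ := exists_C_mul_eq_C_mul P hE f hf0
    have hmem := hf₁ ▸ Q'.mul_mem_left (C (C s)) hf
    rcases hQ'.mem_or_mem hmem with h | h
    · refine hc ?_
      have hbot : (Q'.comap C).comap C = (⊥ : Ideal E) := by
        apply eq_bot_of_comap_eq_bot (R := D)
        rw [eq_bot_iff]
        intro x hx
        have : C x ∈ Q.comap C := by
          rw [← hQQ']
          simpa [algebraMap_def] using hx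
        simpa [hQX] using this
      rw [← Ideal.mem_bot, ← hbot]
      exact h
    · exact hf₁P (hP'_eq ▸ hQP' h)
  rw [← hQQ', hQ'0, ← RingHom.ker_eq_comap_bot, ← RingHom.injective_iff_ker_eq_bot]
  exact hinj

theorem Ideal.height_map_C_map_C_eq_one {D : Type*} [CommRing D] [IsDomain D] (p : Ideal D)
    [p.IsPrime] (hp : (p.map (C : D →+* D[X])).height = 1) :
    ((p.map (C : D →+* D[X])).map (C : D[X] →+* D[X][X])).height = 1 :=
  height_map_C_map_C_eq_one_of_isIntegral (integralClosure D (FractionRing D)) (FractionRing D) p hp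

theorem isSDomain_polynomial (D : Type*) [CommRing D] [IsDomain D] : IsSDomain D[X] := by
  rw [isSDomain_iff_s11]
  intro P hP hP1
  obtain ⟨hP0, h⟩ := P.height_eq_one_iff_of_isDomain.mp hP1
  by_cases hPC : P.comap C = ⊥
  · rw [P.height_map_C_of_comap_eq_bot hPC hP0, hP1]
  · have hle : (P.comap C).map C ≤ P := Ideal.map_comap_le
    have hprime := Ideal.isPrime_map_C_of_isPrime (P := P.comap C)
    have heq : (P.comap C).map C = P := by
      refine hle.eq_of_not_lt fun hlt ↦ hPC ?_
      rw [← Ideal.map_eq_bot_iff_of_injective C_injective]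
      exact h _ hprime hlt
    rw [← heq] at hP1 ⊢
    exact Ideal.height_map_C_map_C_eq_one _ hP1

/-- If `A` satisfies MPC, then `A[X₁,...,Xₙ]` is an S-ring for
every `n ≥ 1`. -/
theorem stmt11 {A : Type*} [CommRing A] (hA : MPC A) (n : ℕ) (hn : 0 < n) :
    SRing (MvPolynomial (Fin n) A) := by
  refine ⟨hA.mvPolynomial, fun P hP ↦ ?_⟩
  obtain ⟨m, rfl⟩ := Nat.exists_eq_succ_of_ne_zero hn.ne'
  have hPC := (Ideal.comap_map_C_mem_minimalPrimes hP).2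
  exact (isSDomain_polynomial _).of_ringEquiv <|
    (MvPolynomial.finSuccEquiv (A ⧸ P.asIdeal.comap MvPolynomial.C) m).symm.toRingEquiv.trans <|
    (MvPolynomial.quotientEquivQuotientMvPolynomial _).toRingEquiv.trans <|
    Ideal.quotEquivOfEq hPC.symm
end

section
/- Let K and L be field extensions of a field k. Then K ⊗_k L is locally finite dimensional (every prime ideal has finite height) if and only if t.d.(K:k) < ∞ or t.d.(L:k) < ∞. -/
open Polynomial TensorProduct

/-- If every element of `B` becomes integral over `A` after multiplication by a unit, then
contraction of primes along `A → B` is strictly monotone. -/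
theorem strictMono_comap_of_forall_exists_isIntegralElem {A B : Type*} [CommRing A] [CommRing B]
    (f : A →+* B) (hf : ∀ b : B, ∃ u : B, IsUnit u ∧ f.IsIntegralElem (u * b)) :
    StrictMono (PrimeSpectrum.comap f) := by
  intro P Q hPQ
  obtain ⟨b, hbQ, hbP⟩ := Set.exists_of_ssubset (show (P.asIdeal : Set B) ⊂ Q.asIdeal from hPQ)
  obtain ⟨u, hu, hub⟩ := hf b
  algebraize [f]
  refine Ideal.comap_lt_comap_of_integral_mem_sdiff (R := A) hPQ.le (x := u * b) ⟨?_, ?_⟩ hub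
  · exact Ideal.mul_mem_left _ _ hbQ
  · intro h
    rcases P.2.mem_or_mem h with h | h
    · exact P.2.ne_top (Ideal.eq_top_of_isUnit_mem _ h hu)
    · exact hbP h

theorem LFD.of_strictMono {A B : Type*} [CommRing A] [CommRing B]
    (f : PrimeSpectrum B → PrimeSpectrum A) (hf : StrictMono f) (hA : LFD A) : LFD B := fun p hp ↦
  hA (f p) (top_le_iff.mp (hp ▸ Order.height_le_height_apply_of_strictMono f hf p))

theorem LFD.of_ringEquiv {A B : Type*} [CommRing A] [CommRing B] (e : A ≃+* B) (hA : LFD A) :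
    LFD B :=
  hA.of_strictMono _ (PrimeSpectrum.comapEquiv e.symm).strictMono

theorem LFD.of_ringKrullDim_lt_top {A : Type*} [CommRing A] (h : ringKrullDim A < ⊤) : LFD A := by
  intro p hp
  have := (Order.height_le_krullDim p).trans_lt h
  simp [hp] at this

theorem LFD.mvPolynomial_of_field (F ι : Type*) [Field F] [Finite ι] :
    LFD (MvPolynomial ι F) := by
  apply LFD.of_ringKrullDim_lt_top
  rw [MvPolynomial.ringKrullDim_of_isNoetherianRing, ringKrullDim_eq_zero_of_field, zero_add]
  exact WithBot.coe_lt_coe.mpr (ENat.natCast_lt_top _)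

/-- For a transcendence basis `x` of `K` over `k`, every element of `L ⊗ K` becomes integral over
the polynomial ring `L[x]` after multiplication by a unit which is itself integral. -/
theorem IsTranscendenceBasis.exists_isIntegralElem_tensorProduct {k K L ι : Type*} [Field k]
    [Field K] [Field L] [Algebra k K] [Algebra k L] {x : ι → K} (hx : IsTranscendenceBasis k x)
    {f : MvPolynomial ι L →+* L ⊗[k] K}
    (hf : f = (MvPolynomial.aeval (R := L) (fun i ↦ (1 : L) ⊗ₜ[k] x i)).toRingHom)
    (z : L ⊗[k] K) :
    ∃ u : L ⊗[k] K, IsUnit u ∧ f.IsIntegralElem u ∧ f.IsIntegralElem (u * z) := by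
  induction z with
  | zero => exact ⟨1, isUnit_one, f.isIntegralElem_one, by simpa using f.isIntegralElem_zero⟩
  | add z w hz hw =>
    obtain ⟨u, hu, hu', hz⟩ := hz
    obtain ⟨v, hv, hv', hw⟩ := hw
    refine ⟨u * v, hu.mul hv, hu'.mul f hv', ?_⟩
    rw [show u * v * (z + w) = v * (u * z) + u * (v * w) by ring]
    exact (hv'.mul f hz).add f (hu'.mul f hw)
  | tmul b a =>
    let R := Algebra.adjoin k (Set.range x)
    let h : R →+* MvPolynomial ι L :=
      (MvPolynomial.map (algebraMap k L)).comp hx.1.aevalEquiv.symm.toRingHom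
    have hcomp : f.comp h =
        (Algebra.TensorProduct.includeRight : K →ₐ[k] L ⊗[k] K).toRingHom.comp
          (algebraMap R K) := by
      ext r
      obtain ⟨p, rfl⟩ := hx.1.aevalEquiv.surjective r
      induction p using MvPolynomial.induction_on with
      | C c => simp [h, hf, Algebra.TensorProduct.tmul_one_eq_one_tmul]
      | add p q hp hq => simpa [TensorProduct.tmul_add] using congrArg₂ (· + ·) hp hq
      | mul_X p i hp =>
        rw [map_mul, map_mul, map_mul, hp]
        congr 1
        simp [h, hf]
    have hint {c : K} (hc : IsIntegral R c) : f.IsIntegralElem (1 ⊗ₜ c) := by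
      algebraize [f]
      exact hc.map_of_comp_eq h _ hcomp
    have := hx.isAlgebraic
    obtain ⟨d, hd, hda⟩ := (Algebra.IsAlgebraic.isAlgebraic (R := R) a).exists_integral_multiple
    have hd' : (d : K) ≠ 0 := by simpa using hd
    refine ⟨1 ⊗ₜ d, hd'.isUnit.map Algebra.TensorProduct.includeRight,
      hint (isIntegral_algebraMap (x := d)), ?_⟩
    rw [show (1 ⊗ₜ d : L ⊗[k] K) * b ⊗ₜ a = b ⊗ₜ 1 * 1 ⊗ₜ (d • a) by
      simp [Algebra.smul_def]]
    refine .mul f ?_ (hint hda)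
    rw [show b ⊗ₜ 1 = f (.C b) by simp [hf]]
    exact f.isIntegralElem_map

theorem LFD.tensorProduct_of_trdeg_lt_aleph0 (k K L : Type*) [Field k] [Field K] [Field L]
    [Algebra k K] [Algebra k L] (h : Algebra.trdeg k K < Cardinal.aleph0) : LFD (L ⊗[k] K) := by
  have := FinTrdeg.of_trdeg h
  obtain ⟨s, hs⟩ := exists_finset_isTranscendenceBasis k K
  exact (LFD.mvPolynomial_of_field L s).of_strictMono _
    (strictMono_comap_of_forall_exists_isIntegralElem _ fun z ↦ by
      obtain ⟨u, hu, -, h⟩ := hs.exists_isIntegralElem_tensorProduct rfl z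
      exact ⟨u, hu, h⟩)

theorem RingHom.Flat.height_comap_le {A B : Type*} [CommRing A] [CommRing B] {f : A →+* B}
    (hf : f.Flat) (Q : PrimeSpectrum B) :
    Order.height (PrimeSpectrum.comap f Q) ≤ Order.height Q := by
  algebraize [f]
  refine Order.height_le fun l hl ↦ ?_
  have : Q.asIdeal.LiesOver l.last.asIdeal := ⟨by rw [hl]; rfl⟩
  obtain ⟨l', hlen, hlast, -⟩ := Ideal.exists_ltSeries_of_hasGoingDown l Q.asIdeal
  rw [← hlen]
  exact Order.length_le_height hlast.le

/-- A prime of the polynomial ring in countably many variables over `K` containing `X i - C (x i)`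
for all `i` has infinite height. -/
theorem MvPolynomial.height_eq_top_of_X_sub_C_mem {K : Type*} [Field K] (x : ℕ → K)
    (Q : PrimeSpectrum (MvPolynomial ℕ K)) (hQ : ∀ i, X i - C (x i) ∈ Q.asIdeal) :
    Order.height Q = ⊤ := by
  let φ (n : ℕ) : MvPolynomial ℕ K →ₐ[K] MvPolynomial ℕ K :=
    aeval fun i ↦ if i < n then C (x i) else X i
  let P (n : ℕ) : PrimeSpectrum (MvPolynomial ℕ K) := ⟨RingHom.ker (φ n), RingHom.ker_isPrime _⟩
  have hφ (n : ℕ) : (φ (n + 1)).comp (φ n) = φ (n + 1) := by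
    ext i : 1
    by_cases hi : i < n
    · simp [φ, hi, hi.le]
    · simp [φ, hi]
  have hP : StrictMono P := by
    refine strictMono_nat_of_lt_succ fun n ↦ lt_of_le_of_ne (fun p hp ↦ ?_) fun h ↦ ?_
    · change φ (n + 1) p = 0
      rw [← hφ, AlgHom.comp_apply, show φ n p = 0 from hp, map_zero]
    · have hn : X n - C (x n) ∈ (P (n + 1)).asIdeal := by
        simp [P, φ, RingHom.mem_ker]
      rw [← h] at hn
      have : X (R := K) n - C (x n) = 0 := by
        simpa [P, φ, RingHom.mem_ker] using hn
      simpa using congrArg (eval fun _ ↦ x n + 1) this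
  have hPQ (n : ℕ) : P n ≤ Q := by
    let π := Ideal.Quotient.mkₐ K Q.asIdeal
    have hπ : π.comp (φ n) = π := by
      ext i : 1
      by_cases hi : i < n
      · have := Ideal.Quotient.eq.mpr (hQ i)
        simpa [φ, hi, π] using this.symm
      · simp [φ, hi]
    intro p hp
    rw [← Ideal.Quotient.eq_zero_iff_mem]
    change π p = 0
    rw [← hπ, AlgHom.comp_apply, show φ n p = 0 from hp, map_zero]
  refine ENat.eq_top_iff_forall_ge.mpr fun n ↦ ?_
  calc (n : ℕ∞) = Order.height n := by simp
    _ ≤ Order.height (P n) := Order.height_le_height_apply_of_strictMono P hP n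
    _ ≤ Order.height Q := Order.height_mono (hPQ n)

theorem AlgebraicIndependent.flat_aeval {k L ι : Type*} [Field k] [Field L] [Algebra k L]
    {y : ι → L} (hy : AlgebraicIndependent k y) :
    (MvPolynomial.aeval (R := k) y).toRingHom.Flat := by
  let F := FractionRing (MvPolynomial ι k)
  have h : (MvPolynomial.aeval (R := k) y).toRingHom =
      (IsFractionRing.lift (K := F) (g := (MvPolynomial.aeval (R := k) y).toRingHom) hy).comp
        (algebraMap (MvPolynomial ι k) F) := by
    ext <;> simp
  rw [h]
  exact .comp (RingHom.flat_algebraMap_iff.mpr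
    (IsLocalization.flat F (nonZeroDivisors (MvPolynomial ι k))))
    (.of_isField (Field.toIsField F) _)

theorem AlgebraicIndependent.flat_aeval_tmul {k L ι : Type*} (K : Type*) [Field k] [Field K]
    [Field L] [Algebra k K] [Algebra k L] {y : ι → L} (hy : AlgebraicIndependent k y) :
    (MvPolynomial.aeval (R := K) (fun i ↦ (1 : K) ⊗ₜ[k] y i)).toRingHom.Flat := by
  let e := MvPolynomial.algebraTensorAlgEquiv (σ := ι) k K
  have h : (MvPolynomial.aeval (R := K) (fun i ↦ (1 : K) ⊗ₜ[k] y i)) =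
      (Algebra.TensorProduct.map (AlgHom.id K K) (MvPolynomial.aeval (R := k) y)).comp
        e.symm.toAlgHom := by
    ext i : 1
    simp [e]
  rw [h]
  exact .comp (.of_bijective e.symm.bijective)
    (RingHom.Flat.tensorProductMap (.id K) hy.flat_aeval)

theorem AlgebraicIndependent.exists_primeSpectrum_tensorProduct {k K L ι : Type*} [Field k]
    [Field K] [Field L] [Algebra k K] [Algebra k L] {x : ι → K} {y : ι → L}
    (hx : AlgebraicIndependent k x) (hy : AlgebraicIndependent k y) :
    ∃ Q : PrimeSpectrum (K ⊗[k] L), ∀ i, 1 ⊗ₜ y i - x i ⊗ₜ 1 ∈ Q.asIdeal := by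
  let F := FractionRing (MvPolynomial ι k)
  let f : F →ₐ[k] K := IsFractionRing.liftAlgHom (K := F) (g := MvPolynomial.aeval x) hx
  let g : F →ₐ[k] L := IsFractionRing.liftAlgHom (K := F) (g := MvPolynomial.aeval y) hy
  let t (i : ι) : F := algebraMap (MvPolynomial ι k) F (MvPolynomial.X i)
  have hf (i : ι) : f (t i) = x i :=
    (IsFractionRing.lift_algebraMap (K := F) hx _).trans (MvPolynomial.aeval_X x i)
  have hg (i : ι) : g (t i) = y i :=
    (IsFractionRing.lift_algebraMap (K := F) hy _).trans (MvPolynomial.aeval_X y i)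
  clear_value f g
  algebraize [f.toRingHom, g.toRingHom]
  have : IsScalarTower k F K := .of_algHom f
  have : IsScalarTower k F L := .of_algHom g
  let π : K ⊗[k] L →ₐ[k] K ⊗[F] L := Algebra.TensorProduct.lift
    (Algebra.TensorProduct.includeLeft)
    (Algebra.TensorProduct.includeRight.restrictScalars k) fun _ _ ↦ .all _ _
  obtain ⟨Q⟩ : Nonempty (PrimeSpectrum (K ⊗[F] L)) := inferInstance
  refine ⟨PrimeSpectrum.comap π.toRingHom Q, fun i ↦ ?_⟩
  have : π (1 ⊗ₜ y i - x i ⊗ₜ 1) = 0 := by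
    have h : (f (t i) ⊗ₜ 1 : K ⊗[F] L) = 1 ⊗ₜ g (t i) :=
      Algebra.TensorProduct.tmul_one_eq_one_tmul (t i)
    simpa [π, sub_eq_zero, hf, hg] using h.symm
  change π _ ∈ Q.asIdeal
  rw [this]
  exact zero_mem _

theorem exists_algebraicIndependent_nat_of_aleph0_le_trdeg {k K : Type*} [Field k] [Field K]
    [Algebra k K] (h : Cardinal.aleph0 ≤ Algebra.trdeg k K) :
    ∃ x : ℕ → K, AlgebraicIndependent k x := by
  obtain ⟨s, hs⟩ := exists_isTranscendenceBasis k K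
  have : Infinite s := Cardinal.infinite_iff.mpr (hs.cardinalMk_eq_trdeg ▸ h)
  let e := Infinite.natEmbedding s
  exact ⟨_, hs.1.comp e e.injective⟩

theorem not_LFD_tensorProduct_of_aleph0_le_trdeg {k K L : Type*} [Field k] [Field K] [Field L]
    [Algebra k K] [Algebra k L] (hK : Cardinal.aleph0 ≤ Algebra.trdeg k K)
    (hL : Cardinal.aleph0 ≤ Algebra.trdeg k L) : ¬ LFD (K ⊗[k] L) := by
  obtain ⟨x, hx⟩ := exists_algebraicIndependent_nat_of_aleph0_le_trdeg hK
  obtain ⟨y, hy⟩ := exists_algebraicIndependent_nat_of_aleph0_le_trdeg hL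
  obtain ⟨Q, hQ⟩ := hx.exists_primeSpectrum_tensorProduct hy
  refine fun h ↦ h Q (top_le_iff.mp ?_)
  refine le_trans (ge_of_eq ?_) ((hy.flat_aeval_tmul K).height_comap_le Q)
  refine MvPolynomial.height_eq_top_of_X_sub_C_mem x _ fun i ↦ ?_
  simpa [Algebra.TensorProduct.algebraMap_apply] using hQ i

/-- For field extensions `K`, `L` of `k`, the ring `K ⊗ₖ L` is
LFD iff `t.d.(K : k) < ∞` or `t.d.(L : k) < ∞`. -/
theorem stmt13 {k K L : Type*} [Field k] [Field K] [Field L] [Algebra k K]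
    [Algebra k L] :
    LFD (K ⊗[k] L) ↔ trdeg k K < Cardinal.aleph0 ∨ trdeg k L < Cardinal.aleph0 := by
  change _ ↔ Algebra.trdeg k K < _ ∨ Algebra.trdeg k L < _
  constructor
  · contrapose!
    exact fun h ↦ not_LFD_tensorProduct_of_aleph0_le_trdeg h.1 h.2
  · rintro (h | h)
    · exact (LFD.tensorProduct_of_trdeg_lt_aleph0 k K L h).of_ringEquiv
        (Algebra.TensorProduct.comm k L K).toRingEquiv
    · exact LFD.tensorProduct_of_trdeg_lt_aleph0 k L K h
end

section
/- Let A and B be k-algebras that are both LFD, and suppose t.d.(A:k) < ∞. Then A ⊗_k B is LFD; more precisely, for every prime P of A⊗_kB, ht(P) ≤ (t.d.(A:k)+1)(ht(P∩A)+1)(ht(P∩B)+1) − 1. -/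
open Polynomial TensorProduct

theorem Order.height_prodMk_le {α β : Type*} [PartialOrder α] [PartialOrder β] (a : α) (b : β) :
    Order.height (a, b) ≤ Order.height a + Order.height b := by
  generalize hn : Order.height a + Order.height b = n
  cases n with
  | top => exact le_top
  | coe n =>
    induction n using Nat.strong_induction_on generalizing a b with
    | h n ih =>
      rw [Order.height_le_coe_iff]
      rintro ⟨a₁, b₁⟩ hlt
      have hfin : Order.height a + Order.height b < ⊤ := hn ▸ ENat.natCast_lt_top n
      have ha : Order.height a < ⊤ := lt_of_le_of_lt le_self_add hfin
      have hb : Order.height b < ⊤ := lt_of_le_of_lt le_add_self hfin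
      have hsum : Order.height a₁ + Order.height b₁ < n := by
        rw [← hn]
        rcases Prod.lt_iff.mp hlt with ⟨h₁, h₂⟩ | ⟨h₁, h₂⟩
        · have ha' := (Order.height_mono h₁.le).trans_lt ha
          exact ENat.add_lt_add_of_lt_of_le
            ((Order.height_mono h₂).trans_lt hb).ne
            (Order.height_strictMono h₁ ha') (Order.height_mono h₂)
        · have hb' := (Order.height_mono h₂.le).trans_lt hb
          exact ENat.add_lt_add_of_le_of_lt
            ((Order.height_mono h₁).trans_lt ha).ne
            (Order.height_mono h₁) (Order.height_strictMono h₂ hb')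
      obtain ⟨m, hm⟩ := ENat.ne_top_iff_exists.mp (hsum.trans_le le_top).ne
      have hmn : m < n := by rw [← hm] at hsum; exact_mod_cast hsum
      exact (ih m hmn a₁ b₁ hm.symm).trans_lt (by exact_mod_cast hmn)

/-- The fibres of `Spec B[X₁, …, Xₙ] → Spec B` have dimension at most `n`. -/
theorem MvPolynomial.krullDim_preimage_comap_C_le {ι B : Type*} [Finite ι] [CommRing B]
    (q : PrimeSpectrum B) :
    Order.krullDim (PrimeSpectrum.comap (C : B →+* MvPolynomial ι B) ⁻¹' {q}) ≤ Nat.card ι := by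
  rw [show (C : B →+* MvPolynomial ι B) = algebraMap B (MvPolynomial ι B) from rfl,
    Order.krullDim_eq_of_orderIso (PrimeSpectrum.preimageOrderIsoFiber B (MvPolynomial ι B) q),
    ← ringKrullDim, ringKrullDim_eq_of_ringEquiv
      (MvPolynomial.algebraTensorAlgEquiv B q.asIdeal.ResidueField).toRingEquiv,
    MvPolynomial.ringKrullDim_of_isNoetherianRing, ringKrullDim_eq_zero_of_field, zero_add]

theorem exists_finite_isTranscendenceBasis_of_trdeg_le {k D : Type*} [Field k] [CommRing D]
    [IsDomain D] [Algebra k D] {d : ℕ} (h : trdeg k D ≤ d) :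
    ∃ s : Set D, Finite s ∧ Nat.card s ≤ d ∧ IsTranscendenceBasis k ((↑) : s → D) := by
  obtain ⟨s, hs⟩ := exists_isTranscendenceBasis k D
  have hcard : Cardinal.mk s ≤ d :=
    (le_ciSup (f := fun t : {t : Set D // AlgebraicIndependent k ((↑) : t → D)} ↦ Cardinal.mk t.1)
      Cardinal.bddAbove_of_small ⟨s, hs.1⟩).trans h
  have hfin : Finite s := Cardinal.lt_aleph0_iff_finite.mp
    (hcard.trans_lt (Cardinal.natCast_lt_aleph0))
  refine ⟨s, hfin, ?_, hs⟩
  rw [← Nat.cast_card (α := s)] at hcard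
  exact_mod_cast hcard

/-- If `x` lifts a family generating a subalgebra over which `A ⧸ (P ∩ A)` is algebraic, then primes
of `A ⊗[k] B` strictly above `P` contract to strictly larger primes of the polynomial ring over `B`. -/
theorem PrimeSpectrum.comap_eval₂Hom_tensorProduct_lt {k A B ι : Type*} [Field k] [CommRing A]
    [CommRing B] [Algebra k A] [Algebra k B] (p : Ideal A) [p.IsPrime] (x : ι → A)
    [Algebra.IsAlgebraic (Algebra.adjoin k (Set.range fun i ↦ Ideal.Quotient.mk p (x i))) (A ⧸ p)]
    {P Q : PrimeSpectrum (A ⊗[k] B)}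
    (hP : P.asIdeal.comap (Algebra.TensorProduct.includeLeftRingHom : A →+* A ⊗[k] B) = p)
    (hPQ : P < Q) :
    PrimeSpectrum.comap (MvPolynomial.eval₂Hom
        (Algebra.TensorProduct.includeRight : B →ₐ[k] A ⊗[k] B).toRingHom
        fun i ↦ x i ⊗ₜ[k] (1 : B)) P <
      PrimeSpectrum.comap (MvPolynomial.eval₂Hom
        (Algebra.TensorProduct.includeRight : B →ₐ[k] A ⊗[k] B).toRingHom
        fun i ↦ x i ⊗ₜ[k] (1 : B)) Q := by
  set ψ : MvPolynomial ι B →+* A ⊗[k] B := MvPolynomial.eval₂Hom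
    (Algebra.TensorProduct.includeRight : B →ₐ[k] A ⊗[k] B).toRingHom
    fun i ↦ x i ⊗ₜ[k] (1 : B) with hψ
  let π : A ⊗[k] B →ₐ[k] (A ⊗[k] B) ⧸ P.asIdeal := Ideal.Quotient.mkₐ k P.asIdeal
  let φ : MvPolynomial ι B →ₐ[k] (A ⊗[k] B) ⧸ P.asIdeal :=
    { toRingHom := (π : A ⊗[k] B →+* _).comp ψ
      commutes' := fun r ↦ by
        change π (ψ (algebraMap k (MvPolynomial ι B) r)) = _
        rw [IsScalarTower.algebraMap_apply k B (MvPolynomial ι B), MvPolynomial.algebraMap_eq, hψ,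
          MvPolynomial.coe_eval₂Hom, MvPolynomial.eval₂_C, ← π.commutes r]
        exact congrArg π (AlgHom.commutes Algebra.TensorProduct.includeRight r) }
  let S : Subalgebra k ((A ⊗[k] B) ⧸ P.asIdeal) := φ.range
  let f : A ⧸ p →ₐ[k] (A ⊗[k] B) ⧸ P.asIdeal :=
    Ideal.quotientMapₐ P.asIdeal
      (Algebra.TensorProduct.includeLeft : A →ₐ[k] A ⊗[k] B) hP.ge
  have hf : Function.Injective f := Ideal.quotientMap_injective' (H := hP.ge) hP.le
  have hmem (y : Algebra.adjoin k (Set.range fun i ↦ Ideal.Quotient.mk p (x i))) :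
      f y ∈ S := by
    have hle : (Algebra.adjoin k (Set.range fun i ↦ Ideal.Quotient.mk p (x i))) ≤ S.comap f := by
      refine Algebra.adjoin_le ?_
      rintro _ ⟨i, rfl⟩
      refine ⟨MvPolynomial.X i, ?_⟩
      change π (ψ (MvPolynomial.X i)) = π (x i ⊗ₜ[k] (1 : B))
      rw [hψ, MvPolynomial.coe_eval₂Hom, MvPolynomial.eval₂_X]
    exact hle y.2
  let g : Algebra.adjoin k (Set.range fun i ↦ Ideal.Quotient.mk p (x i)) →ₐ[k] S :=
    (f.comp (Subalgebra.val _)).codRestrict S hmem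
  have hg : Function.Injective g := fun y z hyz ↦
    Subtype.ext (hf (congrArg Subtype.val hyz))
  have halg_left (a : A) : IsAlgebraic S (π (a ⊗ₜ[k] (1 : B))) :=
    (Algebra.IsAlgebraic.isAlgebraic (Ideal.Quotient.mk p a) :
      IsAlgebraic (Algebra.adjoin k (Set.range fun i ↦ Ideal.Quotient.mk p (x i)))
        (Ideal.Quotient.mk p a)).ringHom_of_comp_eq g f hg (RingHom.ext fun _ ↦ rfl)
  have halg_right (b : B) : IsAlgebraic S (π ((1 : A) ⊗ₜ[k] b)) := by
    refine isAlgebraic_algebraMap (⟨_, MvPolynomial.C b, ?_⟩ : S)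
    change π (ψ (MvPolynomial.C b)) = _
    rw [hψ, MvPolynomial.coe_eval₂Hom, MvPolynomial.eval₂_C]
    rfl
  have halg (t : A ⊗[k] B) : IsAlgebraic S (π t) := by
    induction t using TensorProduct.induction_on with
    | zero => rw [map_zero]; exact isAlgebraic_zero
    | tmul a b =>
      rw [show a ⊗ₜ[k] b = (a ⊗ₜ[k] (1 : B)) * ((1 : A) ⊗ₜ[k] b) by simp, map_mul]
      exact (halg_left a).mul (halg_right b)
    | add s t hs ht => rw [map_add]; exact hs.add ht
  obtain ⟨hle, t, htQ, htP⟩ := SetLike.lt_iff_le_and_exists.mp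
    (show P.asIdeal < Q.asIdeal from hPQ)
  have hne := Ideal.comap_ne_bot_of_algebraic_mem (I := Q.asIdeal.map (π : A ⊗[k] B →+* _))
    (x := π t) (fun h ↦ htP (Ideal.Quotient.eq_zero_iff_mem.mp h))
    (Ideal.mem_map_of_mem _ htQ) (halg t)
  obtain ⟨⟨_, m, rfl⟩, hmQ, hm0⟩ := Submodule.exists_mem_ne_zero_of_ne_bot hne
  refine (PrimeSpectrum.asIdeal_lt_asIdeal _ _).mp <|
    SetLike.lt_iff_le_and_exists.mpr ⟨Ideal.comap_mono hle, m, ?_, fun hmP ↦ ?_⟩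
  · exact (Ideal.mem_quotient_iff_mem hle).mp hmQ
  · exact hm0 (Subtype.ext (Ideal.Quotient.eq_zero_iff_mem.mpr hmP))

/-- Contraction of primes of `A ⊗[k] B` to `A` and `B`. -/
noncomputable def PrimeSpectrum.tensorProductContraction (k A B : Type*) [Field k] [CommRing A]
    [CommRing B] [Algebra k A] [Algebra k B] :
    PrimeSpectrum (A ⊗[k] B) →o PrimeSpectrum A × PrimeSpectrum B where
  toFun P := (PrimeSpectrum.comap Algebra.TensorProduct.includeLeftRingHom P,
    PrimeSpectrum.comap (Algebra.TensorProduct.includeRight : B →ₐ[k] A ⊗[k] B).toRingHom P)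
  monotone' _ _ h := ⟨Ideal.comap_mono h, Ideal.comap_mono h⟩

theorem PrimeSpectrum.krullDim_preimage_tensorProductContraction_le {k A B : Type*} [Field k]
    [CommRing A] [CommRing B] [Algebra k A] [Algebra k B] {d : ℕ}
    (x : PrimeSpectrum A × PrimeSpectrum B) (htd : trdeg k (A ⧸ x.1.asIdeal) ≤ d) :
    Order.krullDim (PrimeSpectrum.tensorProductContraction k A B ⁻¹' {x}) ≤ d := by
  obtain ⟨p, q⟩ := x
  obtain ⟨s, _, hcard, hs⟩ := exists_finite_isTranscendenceBasis_of_trdeg_le htd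
  choose y hy using fun i : s ↦ Ideal.Quotient.mk_surjective (i : A ⧸ p.asIdeal)
  have hrange : (Set.range fun i ↦ Ideal.Quotient.mk p.asIdeal (y i)) =
      Set.range ((↑) : s → A ⧸ p.asIdeal) := by simp only [hy]
  have halg : Algebra.IsAlgebraic
      (Algebra.adjoin k (Set.range fun i ↦ Ideal.Quotient.mk p.asIdeal (y i)))
      (A ⧸ p.asIdeal) := by
    rw [hrange]
    exact hs.isAlgebraic
  let ψ : MvPolynomial s B →+* A ⊗[k] B := MvPolynomial.eval₂Hom
    (Algebra.TensorProduct.includeRight : B →ₐ[k] A ⊗[k] B).toRingHom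
    fun i ↦ y i ⊗ₜ[k] (1 : B)
  have hψ : ψ.comp MvPolynomial.C =
      (Algebra.TensorProduct.includeRight : B →ₐ[k] A ⊗[k] B).toRingHom :=
    MvPolynomial.eval₂Hom_comp_C _ _
  let F : PrimeSpectrum.tensorProductContraction k A B ⁻¹' {(p, q)} →
      PrimeSpectrum.comap (MvPolynomial.C : B →+* MvPolynomial s B) ⁻¹' {q} := fun P ↦
    ⟨PrimeSpectrum.comap ψ P.1, by
      rw [Set.mem_preimage, ← PrimeSpectrum.comap_comp_apply, hψ]
      exact congrArg Prod.snd P.2⟩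
  have hF : StrictMono F := fun P Q hPQ ↦
    PrimeSpectrum.comap_eval₂Hom_tensorProduct_lt p.asIdeal y
      (congrArg (PrimeSpectrum.asIdeal ∘ Prod.fst) P.2) hPQ
  refine (Order.krullDim_le_of_strictMono F hF).trans
    ((MvPolynomial.krullDim_preimage_comap_C_le q).trans ?_)
  exact_mod_cast hcard

/-- If `A`, `B` are LFD `k`-algebras and `t.d.(A : k) ≤ d < ∞`
(i.e. `t.d.(A/p : k) ≤ d` for every prime `p`), then `A ⊗ₖ B` is LFD, and every
prime `P` of `A ⊗ₖ B` satisfies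
`ht P ≤ (d+1)(ht (P ∩ A)+1)(ht (P ∩ B)+1) − 1`. -/
theorem stmt14 {k A B : Type*} [Field k] [CommRing A] [CommRing B] [Algebra k A]
    [Algebra k B] (hA : LFD A) (hB : LFD B) (d : ℕ)
    (htd : ∀ p : PrimeSpectrum A, trdeg k (A ⧸ p.asIdeal) ≤ d) :
    LFD (A ⊗[k] B) ∧
      ∀ P : PrimeSpectrum (A ⊗[k] B),
        Order.height P ≤
          ((d : ℕ∞) + 1) *
            (Order.height
              (PrimeSpectrum.comap (Algebra.TensorProduct.includeLeftRingHom :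
                A →+* A ⊗[k] B) P) + 1) *
            (Order.height
              (PrimeSpectrum.comap ((Algebra.TensorProduct.includeRight :
                B →ₐ[k] A ⊗[k] B).toRingHom) P) + 1) - 1 := by
  have key (P : PrimeSpectrum (A ⊗[k] B)) :=
    (Order.height_le_of_krullDim_preimage_le (PrimeSpectrum.tensorProductContraction k A B)
      (fun x ↦ PrimeSpectrum.krullDim_preimage_tensorProductContraction_le x (htd x.1)) P).trans
    (add_le_add_left (mul_le_mul_right (Order.height_prodMk_le _ _) _) _)
  have bound (P : PrimeSpectrum (A ⊗[k] B)) : Order.height P ≠ ⊤ ∧ Order.height P ≤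
      ((d : ℕ∞) + 1) *
        (Order.height (PrimeSpectrum.comap (Algebra.TensorProduct.includeLeftRingHom :
          A →+* A ⊗[k] B) P) + 1) *
        (Order.height (PrimeSpectrum.comap ((Algebra.TensorProduct.includeRight :
          B →ₐ[k] A ⊗[k] B).toRingHom) P) + 1) - 1 := by
    have hP := key P
    obtain ⟨a, ha⟩ := ENat.ne_top_iff_exists.mp (hA (PrimeSpectrum.comap
      (Algebra.TensorProduct.includeLeftRingHom : A →+* A ⊗[k] B) P))
    obtain ⟨b, hb⟩ := ENat.ne_top_iff_exists.mp (hB (PrimeSpectrum.comap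
      (Algebra.TensorProduct.includeRight : B →ₐ[k] A ⊗[k] B).toRingHom P))
    rw [← ha, ← hb] at hP ⊢
    have hnat : (d + 1) * (a + b) + d ≤ (d + 1) * (a + 1) * (b + 1) - 1 := by
      apply Nat.le_sub_one_of_lt
      nlinarith [Nat.zero_le (d * a * b), Nat.zero_le (a * b)]
    have hP' : Order.height P ≤ (((d + 1) * (a + b) + d : ℕ) : ℕ∞) := by exact_mod_cast hP
    exact ⟨(hP'.trans_lt (ENat.natCast_lt_top _)).ne, hP'.trans (by exact_mod_cast hnat)⟩
  exact ⟨fun P ↦ (bound P).1, fun P ↦ (bound P).2⟩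
end
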